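/- There exists a universal constant C > 0 such that for every n ≥ m ≥ 1 and every ε, δ ∈ (0,1), setting k = ⌈C·(n^{2/3}·m^{1/3}·(log(1/δ))^{1/3}/ε^{4/3} + ((n·m·log(1/δ))^{1/2} + log(1/δ))/ε²)⌉, there exists a randomized tester A using k i.i.d. samples from an unknown distribution p on [n]×[m] such that: for every PMF p on Fin n × Fin m, if p is a product distribution then A outputs YES with probability at least 1 − δ, and if p is ε-far from every product distribution then A outputs YES with probability at most δ. -/

import Mathlib

open scoped BigOperators

/-- `p` is a probability mass function on the finite type `α`. -/
def IsPMF {α : Type*} [Fintype α] (p : α → ℝ) : Prop :=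
  (∀ a, 0 ≤ p a) ∧ ∑ a, p a = 1

/-- `p` is a product distribution on `Fin n × Fin m`. -/
def IsProduct {n m : ℕ} (p : Fin n × Fin m → ℝ) : Prop :=
  ∃ r : Fin n → ℝ, ∃ s : Fin m → ℝ, IsPMF r ∧ IsPMF s ∧ ∀ i j, p (i, j) = r i * s j

/-- `p` is `ε`-far in total variation distance from every product distribution. -/
def FarFromProduct {n m : ℕ} (ε : ℝ) (p : Fin n × Fin m → ℝ) : Prop :=
  ∀ r : Fin n → ℝ, ∀ s : Fin m → ℝ, IsPMF r → IsPMF s →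
    ε ≤ (1 / 2) * ∑ ij : Fin n × Fin m, |p ij - r ij.1 * s ij.2|

/-- Probability that the randomized tester `A` outputs YES given `k` i.i.d. samples from `p`. -/
noncomputable def acceptProb1 {α : Type*} [Fintype α] {k : ℕ} (p : α → ℝ)
    (A : (Fin k → α) → ℝ) : ℝ :=
  ∑ x : Fin k → α, (∏ i, p (x i)) * A x

section helpers
open MeasureTheory ProbabilityTheory
open scoped NNReal

lemma po_exp_hasSum (a : ℝ≥0) (c : ℝ) :
    HasSum (fun n : ℕ => (Real.exp (-a) * a ^ n / (n.factorial : ℝ)) * Real.exp (c * n))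
      (Real.exp (a * (Real.exp c - 1))) := by
  have h := NormedSpace.expSeries_div_hasSum_exp (𝔸 := ℝ) ((a : ℝ) * Real.exp c)
  have h2 := h.mul_left (Real.exp (-a))
  rw [← Real.exp_eq_exp_ℝ, ← Real.exp_add] at h2
  have e1 : (fun n : ℕ => (Real.exp (-a) * a ^ n / (n.factorial : ℝ)) * Real.exp (c * n)) =
      fun i : ℕ => Real.exp (-a) * (((a : ℝ) * Real.exp c) ^ i / (i.factorial : ℝ)) := by
    funext n
    rw [mul_pow, ← Real.exp_nat_mul, mul_comm c]
    ring
  have e2 : (a : ℝ) * (Real.exp c - 1) = -a + a * Real.exp c := by ring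
  rw [e1, e2]
  exact h2

lemma po_exp_integrable (a : ℝ≥0) (c : ℝ) :
    Integrable (fun n : ℕ => Real.exp (c * n)) (poissonMeasure a) := by
  rw [integrable_poissonMeasure_iff]
  have := (po_exp_hasSum a c).summable
  simpa [abs_of_pos (Real.exp_pos _)] using this

lemma po_exp_integral (a : ℝ≥0) (c : ℝ) :
    ∫ n : ℕ, Real.exp (c * n) ∂(poissonMeasure a) = Real.exp (a * (Real.exp c - 1)) := by
  rw [integral_poissonMeasure]
  simpa using (po_exp_hasSum a c).tsum_eq

noncomputable abbrev nu (a b : ℝ≥0) : Measure (ℕ × ℕ) := (poissonMeasure a).prod (poissonMeasure b)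
noncomputable abbrev QQ (a b : ℝ≥0) : Measure ((ℕ × ℕ) × (ℕ × ℕ)) := (nu a b).prod (nu a b)

lemma nu_exp_integrable (a b : ℝ≥0) (c : ℝ) :
    Integrable (fun z : ℕ × ℕ => Real.exp (c * z.1) * Real.exp (c * z.2)) (nu a b) :=
  (po_exp_integrable a c).mul_prod (po_exp_integrable b c)

lemma nu_exp_integral (a b : ℝ≥0) (c d : ℝ) :
    ∫ z : ℕ × ℕ, Real.exp (c * z.1) * Real.exp (d * z.2) ∂(nu a b) =
      Real.exp (a * (Real.exp c - 1) + b * (Real.exp d - 1)) := by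
  rw [nu, integral_prod_mul (fun n : ℕ => Real.exp (c * n)) (fun n : ℕ => Real.exp (d * n)),
    po_exp_integral, po_exp_integral, Real.exp_add]

lemma nu_integrable {a b : ℝ≥0} {f : ℕ × ℕ → ℝ} (K c : ℝ)
    (h : ∀ z, |f z| ≤ K * Real.exp (c * (z.1 + z.2))) : Integrable f (nu a b) := by
  refine ((nu_exp_integrable a b c).const_mul K).mono' (by measurability) ?_
  filter_upwards with z
  have := h z
  rwa [mul_add, Real.exp_add] at this

lemma QQ_integrable {a b : ℝ≥0} {f : (ℕ × ℕ) × (ℕ × ℕ) → ℝ} (K c : ℝ)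
    (h : ∀ w, |f w| ≤ K * Real.exp (c * (w.1.1 + w.1.2 + w.2.1 + w.2.2))) :
    Integrable f (QQ a b) := by
  have h0 : Integrable (fun w : (ℕ × ℕ) × (ℕ × ℕ) =>
      (Real.exp (c * w.1.1) * Real.exp (c * w.1.2)) * (Real.exp (c * w.2.1) * Real.exp (c * w.2.2)))
      (QQ a b) := (nu_exp_integrable a b c).mul_prod (nu_exp_integrable a b c)
  refine (h0.const_mul K).mono' (by measurability) ?_
  filter_upwards with w
  have := h w
  rw [mul_add, mul_add, mul_add, Real.exp_add, Real.exp_add, Real.exp_add] at this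
  simpa [mul_assoc] using this

/-- the per-bin statistic -/
noncomputable def phi (w : (ℕ × ℕ) × (ℕ × ℕ)) : ℝ :=
  |(w.1.1 : ℝ) - w.2.2| + |(w.1.2 : ℝ) - w.2.1| - |(w.1.1 : ℝ) - w.2.1| - |(w.1.2 : ℝ) - w.2.2|

noncomputable def ee (a b : ℝ≥0) : ℝ := ∫ z : ℕ × ℕ, |(z.1 : ℝ) - z.2| ∂(nu a b)

lemma abs_sub_le_exp (x y : ℕ) : |(x : ℝ) - y| ≤ 1 * Real.exp (1 * (x + y)) := by
  have : |(x : ℝ) - y| ≤ x + y := by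
    rw [abs_le]; constructor <;> linarith [x.cast_nonneg (α := ℝ), y.cast_nonneg (α := ℝ)]
  have h2 := Real.add_one_le_exp ((x : ℝ) + y)
  rw [one_mul, one_mul]
  linarith

lemma ee_integrable (a b : ℝ≥0) : Integrable (fun z : ℕ × ℕ => |(z.1 : ℝ) - z.2|) (nu a b) :=
  nu_integrable 1 1 fun z => by rw [abs_abs]; exact abs_sub_le_exp z.1 z.2

lemma ee_symm (a b : ℝ≥0) : ee a b = ee b a := by
  unfold ee
  rw [nu, nu, ← integral_prod_swap]
  congr 1; funext z
  simp [abs_sub_comm]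

/-- integrability / integral of `|.-.|` pulled back along a measure preserving map. -/
lemma pull {Ω : Type*} [MeasurableSpace Ω] {μ : Measure Ω} {a b : ℝ≥0} {T : Ω → ℕ × ℕ}
    (hT : MeasurePreserving T μ (nu a b)) :
    Integrable (fun w => |((T w).1 : ℝ) - (T w).2|) μ ∧
    ∫ w, |((T w).1 : ℝ) - (T w).2| ∂μ = ee a b := by
  constructor
  · exact hT.integrable_comp_of_integrable (ee_integrable a b)
  · unfold ee
    rw [← hT.map_eq, integral_map hT.measurable.aemeasurable]
    exact (by measurability)

lemma comb4 {Ω : Type*} [MeasurableSpace Ω] {μ : Measure Ω} {f1 f2 f3 f4 : Ω → ℝ}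
    (h1 : Integrable f1 μ) (h2 : Integrable f2 μ) (h3 : Integrable f3 μ) (h4 : Integrable f4 μ) :
    Integrable (fun w => f1 w + f2 w - f3 w - f4 w) μ ∧
    ∫ w, (f1 w + f2 w - f3 w - f4 w) ∂μ =
      ∫ w, f1 w ∂μ + ∫ w, f2 w ∂μ - ∫ w, f3 w ∂μ - ∫ w, f4 w ∂μ := by
  have h12 : Integrable (fun w => f1 w + f2 w) μ := h1.add h2
  have h123 : Integrable (fun w => f1 w + f2 w - f3 w) μ := h12.sub h3
  refine ⟨h123.sub h4, ?_⟩
  rw [integral_sub h123 h4, integral_sub h12 h3, integral_add h1 h2]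

lemma phi_integral (a b : ℝ≥0) :
    Integrable phi (QQ a b) ∧ ∫ w, phi w ∂(QQ a b) = 2 * ee a b - ee a a - ee b b := by
  have m1 : MeasurePreserving (Prod.fst : ℕ × ℕ → ℕ) (nu a b) (poissonMeasure a) :=
    measurePreserving_fst
  have m2 : MeasurePreserving (Prod.snd : ℕ × ℕ → ℕ) (nu a b) (poissonMeasure b) :=
    measurePreserving_snd
  obtain ⟨i1, e1⟩ := pull (m1.prod m2)
  obtain ⟨i2, e2⟩ := pull (m2.prod m1)
  obtain ⟨i3, e3⟩ := pull (m1.prod m1)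
  obtain ⟨i4, e4⟩ := pull (m2.prod m2)
  simp only [Prod.map_fst, Prod.map_snd] at i1 e1 i2 e2 i3 e3 i4 e4
  obtain ⟨i, e⟩ := comb4 i1 i2 i3 i4
  refine ⟨i, ?_⟩
  unfold phi
  rw [e, e1, e2, e3, e4, ee_symm b a]
  ring

lemma diff_integral (a d : ℝ≥0) :
    let I : (ℕ × ℕ) × (ℕ × ℕ) → ℝ := fun w =>
      |(w.1.1 : ℝ) - (w.2.1 + w.2.2)| + |((w.1.1 : ℝ) + w.1.2) - w.2.1| - |(w.1.1 : ℝ) - w.2.1|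
        - |((w.1.1 : ℝ) + w.1.2) - (w.2.1 + w.2.2)|
    Integrable I (QQ a d) ∧
      ∫ w, I w ∂(QQ a d) = 2 * ee a (a + d) - ee a a - ee (a + d) (a + d) := by
  intro I
  have m1 : MeasurePreserving (Prod.fst : ℕ × ℕ → ℕ) (nu a d) (poissonMeasure a) :=
    measurePreserving_fst
  have m2 : MeasurePreserving (fun z : ℕ × ℕ => z.1 + z.2) (nu a d) (poissonMeasure (a + d)) :=
    ⟨by measurability, poissonMeasure_conv_poissonMeasure a d⟩
  obtain ⟨i1, e1⟩ := pull (m1.prod m2)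
  obtain ⟨i2, e2⟩ := pull (m2.prod m1)
  obtain ⟨i3, e3⟩ := pull (m1.prod m1)
  obtain ⟨i4, e4⟩ := pull (m2.prod m2)
  simp only [Prod.map_fst, Prod.map_snd, Nat.cast_add] at i1 e1 i2 e2 i3 e3 i4 e4
  obtain ⟨i, e⟩ := comb4 i1 i2 i3 i4
  refine ⟨i, ?_⟩
  simp only [I]
  rw [e, e1, e2, e3, e4, ee_symm (a + d) a]
  ring


lemma po_bdd_integrable {a : ℝ≥0} {f : ℕ → ℝ} (K : ℝ) (h : ∀ n, |f n| ≤ K) :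
    Integrable f (poissonMeasure a) :=
  (integrable_const K).mono' (by measurability) (by filter_upwards with n; exact h n)

/-- Markov-type bound for the real measure of a set. -/
lemma po_real_le {a : ℝ≥0} {A : Set ℕ} {g : ℕ → ℝ} (hg : Integrable g (poissonMeasure a))
    (h0 : ∀ n, 0 ≤ g n) (h1 : ∀ n ∈ A, 1 ≤ g n) :
    (poissonMeasure a).real A ≤ ∫ n, g n ∂(poissonMeasure a) := by
  rw [← integral_indicator_one (MeasurableSet.of_discrete)]
  refine integral_mono ((integrable_const (1:ℝ)).indicator MeasurableSet.of_discrete) hg ?_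
  intro n
  by_cases hn : n ∈ A
  · simpa [hn] using h1 n hn
  · simpa [hn] using h0 n

lemma exp_neg_half_le : Real.exp (-(1/2)) ≤ 5/8 := by
  have h := Real.exp_one_gt_d9
  have h2 : (Real.exp (-(1/2)))^2 * Real.exp 1 = 1 := by
    rw [← Real.exp_nat_mul, ← Real.exp_add]; norm_num
  have h3 := Real.exp_pos (-(1/2))
  by_contra hc
  push Not at hc
  nlinarith

lemma po_lower (u : ℝ≥0) : (poissonMeasure u).real {n : ℕ | (n : ℝ) < u / 2} ≤ Real.exp (-u / 8) := by
  have h := po_real_le (A := {n : ℕ | (n : ℝ) < u / 2})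
    ((po_exp_integrable u (-(1/2))).const_mul (Real.exp (u/4)))
    (fun n => by positivity) (fun n hn => by
      rw [← Real.exp_add]
      apply Real.one_le_exp
      simp only [Set.mem_ofPred_eq] at hn
      linarith)
  rw [integral_const_mul, po_exp_integral, ← Real.exp_add] at h
  refine h.trans (Real.exp_le_exp.mpr ?_)
  have := mul_le_mul_of_nonneg_left exp_neg_half_le u.coe_nonneg
  nlinarith

lemma exp_bound2 {t : ℝ} (ht : |t| ≤ 1) : Real.exp t - 1 - t ≤ t ^ 2 := by
  have := Real.abs_exp_sub_one_sub_id_le ht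
  exact (abs_le.mp this).2

lemma po_conc (a : ℝ≥0) : 3/4 ≤
    (poissonMeasure a).real {n : ℕ | |(n : ℝ) - a| < 4 * Real.sqrt (1 + a)} := by
  set r := Real.sqrt (1 + a) with hr
  have ha := a.coe_nonneg
  have hr2 : r ^ 2 = 1 + a := Real.sq_sqrt (by linarith)
  have hr1 : 1 ≤ r := by rw [hr]; exact Real.one_le_sqrt.mpr (by linarith)
  have hr0 : 0 < r := by linarith
  set t := 1 / r with ht
  have htr : t * r = 1 := by rw [ht]; field_simp
  have ht0 : 0 < t := by positivity
  have ht1 : t ≤ 1 := by rw [ht, div_le_one hr0]; exact hr1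
  have hta : a * t ^ 2 ≤ 1 := by
    have : (t * r)^2 = 1 := by rw [htr]; norm_num
    rw [mul_pow, hr2] at this
    nlinarith [sq_nonneg t]
  -- exponential moments
  have key : ∀ s : ℝ, |s| ≤ 1 → a * s ^ 2 ≤ 1 →
      Real.exp (-4) * ∫ n : ℕ, Real.exp (-s * a) * Real.exp (s * n) ∂(poissonMeasure a)
        ≤ Real.exp (-3) := by
    intro s hs hs2
    rw [integral_const_mul, po_exp_integral, ← Real.exp_add, ← Real.exp_add]
    apply Real.exp_le_exp.mpr
    have := mul_le_mul_of_nonneg_left (exp_bound2 hs) ha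
    nlinarith
  have hI : ∀ s : ℝ, Integrable (fun n : ℕ => Real.exp (-s * a) * Real.exp (s * n)) (poissonMeasure a) :=
    fun s => (po_exp_integrable a s).const_mul _
  have h := po_real_le (A := {n : ℕ | |(n : ℝ) - a| < 4 * r}ᶜ)
    (g := fun n => Real.exp (-4) * (Real.exp (-t * a) * Real.exp (t * n)) +
      Real.exp (-4) * (Real.exp (-(-t) * a) * Real.exp ((-t) * n)))
    (((hI t).const_mul _).add ((hI (-t)).const_mul _))
    (fun n => by positivity) (fun n hn => by
      simp only [Set.mem_compl_iff, Set.mem_ofPred_eq, not_lt] at hn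
      rcases le_abs.mp hn with h | h
      · have : 1 ≤ Real.exp (-4) * (Real.exp (-t * a) * Real.exp (t * n)) := by
          rw [← Real.exp_add, ← Real.exp_add]
          apply Real.one_le_exp
          have := mul_le_mul_of_nonneg_left h ht0.le
          nlinarith
        have h2 : 0 ≤ Real.exp (-4) * (Real.exp (-(-t) * a) * Real.exp ((-t) * n)) := by positivity
        linarith
      · have : 1 ≤ Real.exp (-4) * (Real.exp (-(-t) * a) * Real.exp ((-t) * n)) := by
          rw [← Real.exp_add, ← Real.exp_add]
          apply Real.one_le_exp
          have := mul_le_mul_of_nonneg_left h ht0.le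
          nlinarith
        have h2 : 0 ≤ Real.exp (-4) * (Real.exp (-t * a) * Real.exp (t * n)) := by positivity
        linarith)
  rw [integral_add ((hI t).const_mul _) ((hI (-t)).const_mul _)] at h
  have k1 := key t (by rwa [abs_of_pos ht0]) hta
  have k2 := key (-t) (by rwa [abs_neg, abs_of_pos ht0]) (by simpa using hta)
  rw [measureReal_compl MeasurableSet.of_discrete, probReal_univ] at h
  simp only [integral_const_mul] at h k1 k2
  have e3 : Real.exp (-3) ≤ 1/8 := by
    have h := Real.exp_one_gt_d9
    have h2 : Real.exp (-3) * (Real.exp 1)^3 = 1 := by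
      rw [← Real.exp_nat_mul, ← Real.exp_add]; norm_num
    have h3 : (2:ℝ)^3 ≤ (Real.exp 1)^3 := by gcongr; linarith
    nlinarith [Real.exp_pos (-3)]
  linarith

lemma po_pos (d : ℝ≥0) : (poissonMeasure d).real {n : ℕ | 1 ≤ n} = 1 - Real.exp (-d) := by
  have : {n : ℕ | 1 ≤ n} = {0}ᶜ := by ext n; simp [Nat.one_le_iff_ne_zero]
  rw [this, measureReal_compl MeasurableSet.of_discrete, probReal_univ, poissonMeasure_real_singleton]
  simp

lemma I_lower (x p' x' p : ℝ) (hp : 0 ≤ p) (hp' : 0 ≤ p') (l : ℝ) (hl : l ≤ p) (hl' : l ≤ p')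
    (hw : |x - x'| ≤ l / 2) :
    l ≤ |x - (x' + p)| + |(x + p') - x'| - |x - x'| - |(x + p') - (x' + p)| := by
  obtain ⟨h1, h2⟩ := abs_le.mp hw
  rcases abs_cases (x - (x' + p)) with ⟨e1, _⟩ | ⟨e1, _⟩ <;>
  rcases abs_cases ((x + p') - x') with ⟨e2, _⟩ | ⟨e2, _⟩ <;>
  rcases abs_cases (x - x') with ⟨e3, _⟩ | ⟨e3, _⟩ <;>
  rcases abs_cases ((x + p') - (x' + p)) with ⟨e4, _⟩ | ⟨e4, _⟩ <;>
  rw [e1, e2, e3, e4] <;> linarith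

lemma I_nonneg (x p' x' p : ℝ) (hp : 0 ≤ p) (hp' : 0 ≤ p') :
    0 ≤ |x - (x' + p)| + |(x + p') - x'| - |x - x'| - |(x + p') - (x' + p)| := by
  rcases abs_cases (x - (x' + p)) with ⟨e1, _⟩ | ⟨e1, _⟩ <;>
  rcases abs_cases ((x + p') - x') with ⟨e2, _⟩ | ⟨e2, _⟩ <;>
  rcases abs_cases (x - x') with ⟨e3, _⟩ | ⟨e3, _⟩ <;>
  rcases abs_cases ((x + p') - (x' + p)) with ⟨e4, _⟩ | ⟨e4, _⟩ <;>
  rw [e1, e2, e3, e4] <;> linarith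

noncomputable def DD (a b : ℝ≥0) : ℝ := 2 * ee a b - ee a a - ee b b

lemma DD_bucket (a d : ℝ≥0) (l : ℕ) (h : ℕ) (hh : 0 < h) (hl : 2 * (h - 1) ≤ l) (S : Finset ℕ) :
    (l : ℝ) * ∑ β ∈ S, ((poissonMeasure a).real {n | n / h = β} *
      (poissonMeasure d).real {n | l ≤ n}) ^ 2 ≤ DD a (a + d) := by
  classical
  obtain ⟨hI, hE⟩ := diff_integral a d
  unfold DD
  rw [← hE]
  set F : ℕ → ℕ × ℕ → ℝ := fun β z =>
    ({n | n / h = β} : Set ℕ).indicator 1 z.1 * ({n | l ≤ n} : Set ℕ).indicator 1 z.2 with hF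
  have hFb : ∀ β z, F β z = if z.1 / h = β ∧ l ≤ z.2 then 1 else 0 := by
    intro β z
    simp only [hF, Set.indicator_apply, Set.mem_ofPred_eq, Pi.one_apply]
    split_ifs <;> simp_all
  have hFint : ∀ β, ∫ z, F β z ∂(nu a d) = (poissonMeasure a).real {n | n / h = β} *
      (poissonMeasure d).real {n | l ≤ n} := by
    intro β
    simp only [hF]
    rw [nu, integral_prod_mul (fun n : ℕ => ({n | n / h = β} : Set ℕ).indicator (1 : ℕ → ℝ) n)
      (fun n : ℕ => ({n | l ≤ n} : Set ℕ).indicator (1 : ℕ → ℝ) n),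
      integral_indicator_one MeasurableSet.of_discrete,
      integral_indicator_one MeasurableSet.of_discrete]
  have hFi : ∀ β, Integrable (F β) (nu a d) := fun β => by
    refine nu_integrable 1 0 fun z => ?_
    rw [hFb]; split_ifs <;> simp
  have hFF : ∀ β, Integrable (fun w : (ℕ × ℕ) × (ℕ × ℕ) => F β w.1 * F β w.2) (QQ a d) :=
    fun β => (hFi β).mul_prod (hFi β)
  have e : (l : ℝ) * ∑ β ∈ S, ((poissonMeasure a).real {n | n / h = β} *
      (poissonMeasure d).real {n | l ≤ n}) ^ 2 =
      ∫ w, (l : ℝ) * ∑ β ∈ S, F β w.1 * F β w.2 ∂(QQ a d) := by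
    rw [integral_const_mul, integral_finsetSum _ (fun β _ => hFF β)]
    congr 1
    refine Finset.sum_congr rfl fun β _ => ?_
    rw [QQ, integral_prod_mul (F β) (F β), hFint, sq]
  rw [e]
  refine integral_mono ((integrable_finsetSum _ fun β _ => hFF β).const_mul _) hI ?_
  rintro ⟨⟨x, p'⟩, ⟨x', p⟩⟩
  simp only [hFb]
  by_cases hc : x / h = x' / h ∧ l ≤ p' ∧ l ≤ p
  · obtain ⟨h1, h2, h3⟩ := hc
    have hs : ∑ β ∈ S, (if x / h = β ∧ l ≤ p' then (1:ℝ) else 0) * (if x' / h = β ∧ l ≤ p then 1 else 0) ≤ 1 := by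
      have : ∀ β ∈ S, (if x / h = β ∧ l ≤ p' then (1:ℝ) else 0) * (if x' / h = β ∧ l ≤ p then 1 else 0)
          ≤ if x / h = β then 1 else 0 := by
        intro β _
        split_ifs <;> simp_all
      refine (Finset.sum_le_sum this).trans ?_
      rw [Finset.sum_ite_eq]
      split_ifs <;> simp
    have hx : |(x:ℝ) - x'| ≤ (l:ℝ) / 2 := by
      have e1 := Nat.div_add_mod x h
      have e2 := Nat.div_add_mod x' h
      rw [← h1] at e2
      have m1 := Nat.mod_lt x hh
      have m2 := Nat.mod_lt x' hh
      have : (x:ℝ) ≤ x' + (h - 1 : ℕ) := by exact_mod_cast (by omega : x ≤ x' + (h-1))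
      have : (x':ℝ) ≤ x + (h - 1 : ℕ) := by exact_mod_cast (by omega : x' ≤ x + (h-1))
      have : 2 * ((h - 1 : ℕ):ℝ) ≤ l := by exact_mod_cast hl
      rw [abs_le]; constructor <;> linarith
    have := I_lower x p' x' p (by positivity) (by positivity) l (by exact_mod_cast h3) (by exact_mod_cast h2) hx
    have h0 : (0:ℝ) ≤ l := by positivity
    calc _ ≤ (l:ℝ) * 1 := by gcongr
      _ ≤ _ := by rw [mul_one]; exact this
  · have : ∑ β ∈ S, (if x / h = β ∧ l ≤ p' then (1:ℝ) else 0) * (if x' / h = β ∧ l ≤ p then 1 else 0) = 0 := by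
      refine Finset.sum_eq_zero fun β _ => ?_
      split_ifs with h1 h2
      · exact absurd ⟨h1.1.trans h2.1.symm, h1.2, h2.2⟩ hc
      all_goals simp
    rw [this, mul_zero]
    exact I_nonneg x p' x' p (by positivity) (by positivity)

lemma calc_aux (q l c s r D : ℝ) (hl : 0 ≤ l) (hs : 0 ≤ s) (hr : 0 ≤ r) (h1 : 9/16 ≤ c * s)
    (h2 : c * l ≤ r + 2 * l) (h3 : l * (q^2 * s) ≤ D) :
    (9/16) * q^2 * l^2 ≤ D * (r + 2 * l) := by
  calc (9/16) * q^2 * l^2 ≤ (c * s) * q^2 * l^2 := by gcongr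
    _ = (l * (q^2 * s)) * (c * l) := by ring
    _ ≤ (l * (q^2 * s)) * (r + 2 * l) := by gcongr
    _ ≤ _ := by gcongr

lemma DD_step (a d : ℝ≥0) (l : ℕ) (hl : 1 ≤ l) :
    (9/16) * (poissonMeasure d).real {n | l ≤ n} ^ 2 * (l:ℝ)^2 ≤
      DD a (a + d) * (16 * Real.sqrt (1 + a) + 2 * l) := by
  set r := Real.sqrt (1 + a) with hr
  have ha := a.coe_nonneg
  have hr0 : 0 < r := by rw [hr]; positivity
  set h := l / 2 + 1 with hh
  set lo := ⌈(a:ℝ) - 4 * r⌉₊ with hlo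
  set hi := ⌊(a:ℝ) + 4 * r⌋₊ with hhi
  set S := Finset.Icc (lo / h) (hi / h) with hS
  have hl0 : (0:ℝ) < l := by exact_mod_cast hl
  have hh0 : (0:ℝ) < h := by rw [hh]; positivity
  have hhl : (l:ℝ) ≤ 2 * h := by exact_mod_cast (by omega : l ≤ 2 * h)
  have hb := DD_bucket a d l h (by omega) (by omega) S
  set q := (poissonMeasure d).real {n | l ≤ n} with hq
  set P : ℕ → ℝ := fun β => (poissonMeasure a).real {n | n / h = β} with hP
  have hsum : 3/4 ≤ ∑ β ∈ S, P β := by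
    refine (po_conc a).trans ?_
    refine le_trans (measureReal_mono (s₂ := ⋃ β ∈ S, {n | n / h = β}) ?_ (measure_ne_top _ _)) (measureReal_biUnion_finset_le _ _)
    intro n hn
    simp only [Set.mem_ofPred_eq] at hn
    obtain ⟨h1, h2⟩ := abs_lt.mp hn
    simp only [Set.mem_iUnion, Set.mem_ofPred_eq, exists_prop, exists_eq_right', hS, Finset.mem_Icc]
    constructor
    · apply Nat.div_le_div_right
      rw [hlo, Nat.ceil_le]; linarith
    · apply Nat.div_le_div_right
      rw [hhi]; apply Nat.le_floor; linarith
  have hcard : (S.card : ℝ) * l ≤ 16 * r + 2 * l := by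
    have c1 : (S.card : ℝ) ≤ (8 * r) / h + 2 := by
      rw [hS, Nat.card_Icc]
      have f1 : ((hi / h : ℕ):ℝ) ≤ (a + 4 * r) / h := by
        refine Nat.cast_div_le.trans ?_
        gcongr
        exact Nat.floor_le (by positivity)
      have f2 : ((a:ℝ) - 4 * r) / h - 1 ≤ ((lo / h : ℕ):ℝ) := by
        have : (lo:ℝ) ≤ h * ((lo / h : ℕ):ℝ) + h := by
          have e1 := Nat.div_add_mod lo h
          have m1 := Nat.mod_lt lo (show 0 < h by omega)
          exact_mod_cast (by omega : lo ≤ h * (lo / h) + h)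
        have h3 : (a:ℝ) - 4 * r ≤ lo := Nat.le_ceil _
        rw [sub_le_iff_le_add, div_le_iff₀ hh0]
        nlinarith
      rcases le_total (lo / h) (hi / h + 1) with hc | hc
      · rw [Nat.cast_sub hc]
        push_cast
        have : (8 * r) / h = (a + 4 * r) / h - ((a:ℝ) - 4 * r) / h := by ring
        linarith
      · rw [Nat.sub_eq_zero_of_le hc]
        push_cast
        positivity
    have c2 : (8 * r) / h * l ≤ 16 * r := by
      rw [div_mul_eq_mul_div, div_le_iff₀ hh0]
      nlinarith
    nlinarith
  have hcs := sq_sum_le_card_mul_sum_sq (s := S) (f := P)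
  have e : ∑ β ∈ S, ((poissonMeasure a).real {n | n / h = β} * q) ^ 2 = q^2 * ∑ β ∈ S, P β ^ 2 := by
    rw [Finset.mul_sum]; refine Finset.sum_congr rfl fun β _ => ?_
    rw [hP]; ring
  rw [e] at hb
  set sg2 := ∑ β ∈ S, P β ^ 2 with hsg
  have hsg0 : 0 ≤ sg2 := Finset.sum_nonneg fun _ _ => sq_nonneg _
  have h916 : 9/16 ≤ (S.card:ℝ) * sg2 := by nlinarith
  exact calc_aux q l S.card sg2 (16 * r) (DD a (a + d)) hl0.le hsg0 (by positivity) h916 hcard hb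

/-- lower bound for the expected gap -/
lemma DD_lower (a d : ℝ≥0) :
    (1/2592) * ((d:ℝ)^2 / (d + Real.sqrt (1 + a))) ≤ DD a (a + d) := by
  set r := Real.sqrt (1 + a) with hr
  have ha := a.coe_nonneg
  have hd := d.coe_nonneg
  have hr1 : 1 ≤ r := by rw [hr]; exact Real.one_le_sqrt.mpr (by linarith)
  rw [← mul_div_assoc, div_le_iff₀ (by linarith)]
  rcases le_total (8:ℝ) d with h8 | h8
  · have hs := DD_step a d ⌈(d:ℝ)/2⌉₊ (by rw [Nat.one_le_ceil_iff]; linarith)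
    have hq : 1/2 ≤ (poissonMeasure d).real {n | ⌈(d:ℝ)/2⌉₊ ≤ n} := by
      have e : {n : ℕ | ⌈(d:ℝ)/2⌉₊ ≤ n} = {n : ℕ | (n : ℝ) < d / 2}ᶜ := by
        ext n; simp [Nat.ceil_le]
      rw [e, measureReal_compl MeasurableSet.of_discrete, probReal_univ]
      have := po_lower d
      have h2 : Real.exp (-d / 8) ≤ Real.exp (-(1/2)) := Real.exp_le_exp.mpr (by linarith)
      have h3 : Real.exp (-d / 8) ≤ Real.exp (-1) := Real.exp_le_exp.mpr (by linarith)
      have h4 : Real.exp (-1) ≤ 1/2 := by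
        have h := Real.exp_one_gt_d9
        have h2 : Real.exp (-1) * (Real.exp 1) = 1 := by
          rw [← Real.exp_add]; norm_num
        nlinarith [Real.exp_pos (-1)]
      linarith
    set q := (poissonMeasure d).real {n | ⌈(d:ℝ)/2⌉₊ ≤ n}
    set l := ⌈(d:ℝ)/2⌉₊ with hl
    have l1 : (d:ℝ)/2 ≤ l := Nat.le_ceil _
    have l2 : (l:ℝ) < d/2 + 1 := Nat.ceil_lt_add_one (by positivity)
    have k1 : (9/16) * (1/2)^2 * (d/2:ℝ)^2 ≤ (9/16) * q^2 * (l:ℝ)^2 := by gcongr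
    have k0 : 0 ≤ DD a (a+d) := by
      by_contra hc
      push Not at hc
      have : 0 < 16 * r + 2 * (l:ℝ) := by positivity
      nlinarith
    have k2 : DD a (a + d) * (16 * r + 2 * l) ≤ DD a (a + d) * (18 * (d + r)) := by
      gcongr; linarith
    nlinarith
  · have hs := DD_step a d 1 le_rfl
    rw [po_pos] at hs
    have hq : (d:ℝ)/9 ≤ 1 - Real.exp (-d) := by
      have h1 := Real.add_one_le_exp (d:ℝ)
      have h2 : Real.exp (-d) * Real.exp d = 1 := by rw [← Real.exp_add]; simp
      have h3 := Real.exp_pos (-d:ℝ)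
      have h4 : Real.exp (-d) * (d + 1) ≤ 1 := by nlinarith
      by_contra hc
      push Not at hc
      nlinarith
    set q := 1 - Real.exp (-d:ℝ)
    have k1 : (9/16) * (d/9:ℝ)^2 ≤ (9/16) * q^2 := by gcongr
    push_cast at hs
    have k0 : 0 ≤ DD a (a+d) := by
      by_contra hc
      push Not at hc
      have : 0 < 16 * r + 2 * (1:ℝ) := by positivity
      nlinarith
    have k2 : DD a (a + d) * (16 * r + 2 * 1) ≤ DD a (a + d) * (18 * (d + r)) := by
      gcongr; linarith
    nlinarith


lemma exp_quad (x : ℝ) : Real.exp x ≤ 1 + x + x^2 * Real.exp |x| := by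
  have h := Complex.norm_exp_sub_sum_le_norm_mul_exp (x : ℂ) 2
  simp only [Finset.sum_range_succ, Finset.sum_range_zero] at h
  norm_num at h
  have e : Complex.exp x - (1 + x) = ((Real.exp x - (1 + x) : ℝ) : ℂ) := by push_cast; rfl
  rw [e, Complex.norm_real, Real.norm_eq_abs] at h
  have := (abs_le.mp h).2
  linarith

lemma t_exp_le (t : ℝ) (ht : 0 ≤ t) : t * Real.exp (t/8) ≤ (8/7) * (Real.exp t - 1) := by
  have h1 : Real.exp t = Real.exp (t/8) * Real.exp (7*t/8) := by rw [← Real.exp_add]; ring_nf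
  have h2 := Real.add_one_le_exp (7*t/8)
  have h3 : 1 ≤ Real.exp (t/8) := Real.one_le_exp (by positivity)
  rw [h1]
  nlinarith

lemma phi_abs1 (w : (ℕ × ℕ) × (ℕ × ℕ)) : |phi w| ≤ 2 * (w.1.1 + w.1.2) := by
  unfold phi
  have := w.1.1.cast_nonneg (α := ℝ)
  have := w.1.2.cast_nonneg (α := ℝ)
  generalize (w.1.1:ℝ) = x at *
  generalize (w.1.2:ℝ) = y' at *
  generalize (w.2.1:ℝ) = x'
  generalize (w.2.2:ℝ) = y
  have k1 := abs_sub_abs_le_abs_sub (x - y) (y' - y)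
  have k2 := abs_sub_abs_le_abs_sub (y' - x') (x - x')
  have k3 := abs_sub_abs_le_abs_sub (y' - y) (x - y)
  have k4 := abs_sub_abs_le_abs_sub (x - x') (y' - x')
  have e : |x - y'| ≤ x + y' := by rw [abs_le]; constructor <;> linarith
  rw [show x - y - (y' - y) = x - y' by ring] at k1
  rw [show y' - x' - (x - x') = -(x - y') by ring, abs_neg] at k2
  rw [show y' - y - (x - y) = -(x - y') by ring, abs_neg] at k3
  rw [show x - x' - (y' - x') = x - y' by ring] at k4
  rw [abs_le]; constructor <;> linarith

lemma phi_abs2 (w : (ℕ × ℕ) × (ℕ × ℕ)) : |phi w| ≤ 2 * (w.2.1 + w.2.2) := by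
  have h := phi_abs1 (w.2, w.1)
  have e : phi (w.2, w.1) = phi w := by
    simp only [phi]
    rw [abs_sub_comm (w.2.1:ℝ) w.1.2, abs_sub_comm (w.2.2:ℝ) w.1.1, abs_sub_comm (w.2.1:ℝ) w.1.1,
      abs_sub_comm (w.2.2:ℝ) w.1.2]
    ring
  rwa [e] at h

lemma phi_exp_integrable (a b : ℝ≥0) (l : ℝ) : Integrable (fun w => Real.exp (l * phi w)) (QQ a b) := by
  refine QQ_integrable 1 (|l|) fun w => ?_
  rw [abs_of_pos (Real.exp_pos _), one_mul, Real.exp_le_exp]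
  have h1 := phi_abs1 w
  have h2 := phi_abs2 w
  calc l * phi w ≤ |l * phi w| := le_abs_self _
    _ = |l| * |phi w| := abs_mul _ _
    _ ≤ _ := by gcongr; linarith

lemma mgf_small (a b : ℝ≥0) (l : ℝ) (hl : |l| ≤ 1/8) (hs : (a:ℝ) + b ≤ 1) :
    ∫ w, Real.exp (l * phi w) ∂(QQ a b) ≤ Real.exp (l * DD a b + 400 * l^2 * (a + b)^2) := by
  set G : ℕ × ℕ → ℝ := fun z => Real.exp (1 * z.1) * Real.exp (1 * z.2) - 1 with hG
  have hGi : Integrable G (nu a b) := (nu_exp_integrable a b 1).sub (integrable_const _)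
  have hGv : ∫ z, G z ∂(nu a b) = Real.exp ((a + b) * (Real.exp 1 - 1)) - 1 := by
    rw [hG, integral_sub (nu_exp_integrable a b 1) (integrable_const _), nu_exp_integral]
    simp [← add_mul]
  have hGb : ∫ z, G z ∂(nu a b) ≤ 7 * (a + b) := by
    rw [hGv]
    have hc := convexOn_exp.2 (Set.mem_univ (0:ℝ)) (Set.mem_univ (Real.exp 1 - 1))
      (show (0:ℝ) ≤ 1 - (a + b) by linarith) (show (0:ℝ) ≤ a + b by positivity) (by ring)
    simp only [smul_eq_mul, mul_zero, zero_add, Real.exp_zero, mul_one] at hc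
    have h1 : Real.exp (Real.exp 1 - 1) ≤ 8 := by
      have := Real.exp_one_lt_d9
      calc Real.exp (Real.exp 1 - 1) ≤ Real.exp 2 := Real.exp_le_exp.mpr (by linarith)
        _ = Real.exp 1 * Real.exp 1 := by rw [← Real.exp_add]; norm_num
        _ ≤ 8 := by nlinarith [Real.exp_pos 1]
    have : (0:ℝ) ≤ a + b := by positivity
    nlinarith
  have hG0 : 0 ≤ ∫ z, G z ∂(nu a b) := integral_nonneg fun z => by
    simp only [hG]
    rw [← Real.exp_add]
    have : (1:ℝ) ≤ Real.exp (1 * (z.1:ℝ) + 1 * z.2) := Real.one_le_exp (by positivity)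
    simpa using this
  have hpw : ∀ w, Real.exp (l * phi w) ≤ (1 + l * phi w) + (6 * l^2) * (G w.1 * G w.2) := by
    intro w
    have h := exp_quad (l * phi w)
    have h1 := phi_abs1 w
    have h2 := phi_abs2 w
    set t1 : ℝ := w.1.1 + w.1.2 with ht1
    set t2 : ℝ := w.2.1 + w.2.2 with ht2
    have ht10 : 0 ≤ t1 := by positivity
    have ht20 : 0 ≤ t2 := by positivity
    have g1 : G w.1 = Real.exp t1 - 1 := by simp [hG, ht1, Real.exp_add]
    have g2 : G w.2 = Real.exp t2 - 1 := by simp [hG, ht2, Real.exp_add]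
    have q : phi w ^ 2 ≤ 4 * (t1 * t2) := by
      rw [← sq_abs, sq]
      calc |phi w| * |phi w| ≤ (2 * t1) * (2 * t2) := by gcongr
        _ = _ := by ring
    have e : Real.exp |l * phi w| ≤ Real.exp (t1/8) * Real.exp (t2/8) := by
      rw [← Real.exp_add, Real.exp_le_exp, abs_mul]
      calc |l| * |phi w| ≤ 1/8 * (t1 + t2) := by gcongr; linarith
        _ = _ := by ring
    have k1 := t_exp_le t1 ht10
    have k2 := t_exp_le t2 ht20
    have : phi w ^ 2 * Real.exp |l * phi w| ≤ 6 * (G w.1 * G w.2) := by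
      calc phi w ^ 2 * Real.exp |l * phi w| ≤ (4 * (t1 * t2)) * (Real.exp (t1/8) * Real.exp (t2/8)) := by
            gcongr
        _ = 4 * ((t1 * Real.exp (t1/8)) * (t2 * Real.exp (t2/8))) := by ring
        _ ≤ 4 * (((8/7) * (Real.exp t1 - 1)) * ((8/7) * (Real.exp t2 - 1))) := by
            gcongr
            have : 1 ≤ Real.exp t1 := Real.one_le_exp ht10
            linarith
        _ ≤ _ := by
            rw [g1, g2]
            have : 1 ≤ Real.exp t1 := Real.one_le_exp ht10
            have : 1 ≤ Real.exp t2 := Real.one_le_exp ht20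
            have : 0 ≤ (Real.exp t1 - 1) * (Real.exp t2 - 1) := mul_nonneg (by linarith) (by linarith)
            nlinarith
    have : l^2 * (phi w ^ 2 * Real.exp |l * phi w|) ≤ l^2 * (6 * (G w.1 * G w.2)) := by gcongr
    nlinarith
  obtain ⟨pi, pv⟩ := phi_integral a b
  have i1 : Integrable (fun w => 1 + l * phi w) (QQ a b) := (integrable_const _).add (pi.const_mul l)
  have i2 : Integrable (fun w : (ℕ × ℕ) × (ℕ × ℕ) => (6 * l^2) * (G w.1 * G w.2)) (QQ a b) :=
    (hGi.mul_prod hGi).const_mul _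
  have hint := integral_mono (phi_exp_integrable a b l) (i1.add i2) hpw
  have e1 : ∫ w, ((1 + l * phi w) + (6 * l^2) * (G w.1 * G w.2)) ∂(QQ a b) =
      1 + l * DD a b + (6 * l^2) * ((∫ z, G z ∂(nu a b)) * ∫ z, G z ∂(nu a b)) := by
    rw [integral_add i1 i2, integral_add (integrable_const _) (pi.const_mul l), integral_const_mul,
      integral_const_mul, integral_prod_mul G G, pv]
    simp [DD]
  have hint := hint.trans_eq e1
  refine hint.trans ?_
  have : (∫ z, G z ∂(nu a b)) * ∫ z, G z ∂(nu a b) ≤ (7 * (a + b)) * (7 * (a + b)) := by gcongr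
  have h3 := Real.add_one_le_exp (l * DD a b + 400 * l^2 * ((a:ℝ) + b)^2)
  have : (6 * l^2) * ((∫ z, G z ∂(nu a b)) * ∫ z, G z ∂(nu a b)) ≤ (6 * l^2) * ((7 * (a + b)) * (7 * (a + b))) := by gcongr
  have : 0 ≤ l^2 * ((a:ℝ)+b)^2 := by positivity
  nlinarith

lemma exp_mean2 (x y : ℝ) : Real.exp ((x + y)/2) ≤ (Real.exp x + Real.exp y)/2 := by
  have h1 : Real.exp x = Real.exp (x/2)^2 := by rw [← Real.exp_nat_mul]; congr 1; push_cast; ring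
  have h2 : Real.exp y = Real.exp (y/2)^2 := by rw [← Real.exp_nat_mul]; congr 1; push_cast; ring
  have h3 : Real.exp ((x+y)/2) = Real.exp (x/2) * Real.exp (y/2) := by
    rw [← Real.exp_add]; congr 1; ring
  rw [h1, h2, h3]; nlinarith [sq_nonneg (Real.exp (x/2) - Real.exp (y/2))]

lemma exp_mean4 (x y z w : ℝ) : Real.exp ((x + y + z + w)/4) ≤
    (Real.exp x + Real.exp y + Real.exp z + Real.exp w)/4 := by
  have h := exp_mean2 ((x+y)/2) ((z+w)/2)
  have h1 := exp_mean2 x y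
  have h2 := exp_mean2 z w
  rw [show ((x+y)/2 + (z+w)/2)/2 = (x + y + z + w)/4 by ring] at h
  linarith

lemma cosh_bd (u x y z w : ℝ) (h : |u| ≤ (|x| + |y| + |z| + |w|)/4) :
    Real.exp u + Real.exp (-u) ≤ ((Real.exp x + Real.exp (-x)) + (Real.exp y + Real.exp (-y)) +
      (Real.exp z + Real.exp (-z)) + (Real.exp w + Real.exp (-w)))/4 := by
  have c : ∀ t : ℝ, Real.exp t + Real.exp (-t) = 2 * Real.cosh t := fun t => by
    rw [Real.cosh_eq]; ring
  have c2 : ∀ t : ℝ, Real.exp |t| + Real.exp (-|t|) = Real.exp t + Real.exp (-t) := fun t => by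
    rw [c, c, Real.cosh_abs]
  have h0 : Real.exp u + Real.exp (-u) ≤ 2 * Real.cosh ((|x| + |y| + |z| + |w|)/4) := by
    rw [c]
    gcongr
    rw [Real.cosh_le_cosh]
    exact h.trans (le_abs_self _)
  rw [← c] at h0
  have h1 := exp_mean4 (|x|) (|y|) (|z|) (|w|)
  have h2 := exp_mean4 (-|x|) (-|y|) (-|z|) (-|w|)
  rw [show (-|x| + -|y| + -|z| + -|w|)/4 = -((|x| + |y| + |z| + |w|)/4) by ring] at h2
  rw [← c2 x, ← c2 y, ← c2 z, ← c2 w]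
  linarith

lemma sym_coord {Ω : Type*} [MeasurableSpace Ω] {μ : Measure Ω} [SFinite μ] {a : ℝ≥0} {X : Ω → ℕ}
    (hX : MeasurePreserving X μ (poissonMeasure a)) (c : ℝ) :
    Integrable (fun v : Ω × Ω => Real.exp (c * ((X v.1 : ℝ) - X v.2))) (μ.prod μ) ∧
    ∫ v, Real.exp (c * ((X v.1 : ℝ) - X v.2)) ∂(μ.prod μ) =
      Real.exp (a * (Real.exp c + Real.exp (-c) - 2)) := by
  have e : (fun v : Ω × Ω => Real.exp (c * ((X v.1 : ℝ) - X v.2))) =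
      fun v => Real.exp (c * X v.1) * Real.exp (-c * X v.2) := by
    funext v; rw [← Real.exp_add]; congr 1; ring
  have i : ∀ c : ℝ, Integrable (fun w => Real.exp (c * X w)) μ := fun c =>
    hX.integrable_comp_of_integrable (po_exp_integrable a c)
  have f : ∀ c : ℝ, ∫ w, Real.exp (c * X w) ∂μ = Real.exp (a * (Real.exp c - 1)) := fun c => by
    rw [← po_exp_integral a c, ← hX.map_eq, integral_map hX.measurable.aemeasurable]
    exact (by measurability)
  rw [e]
  refine ⟨(i c).mul_prod (i (-c)), ?_⟩
  rw [integral_prod_mul (fun w => Real.exp (c * X w)) (fun w => Real.exp (-c * X w)), f, f, ← Real.exp_add]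
  congr 1; ring

lemma phi_lip (w v : (ℕ × ℕ) × (ℕ × ℕ)) : |phi w - phi v| ≤
    2 * (|(w.1.1:ℝ) - v.1.1| + |(w.1.2:ℝ) - v.1.2| + |(w.2.1:ℝ) - v.2.1| + |(w.2.2:ℝ) - v.2.2|) := by
  unfold phi
  have k : ∀ p q r s : ℝ, |(|p - q| - |r - s|)| ≤ |p - r| + |q - s| := fun p q r s => by
    refine (abs_abs_sub_abs_le_abs_sub _ _).trans ?_
    rw [show p - q - (r - s) = (p - r) - (q - s) by ring]
    exact abs_sub _ _
  have h1 := abs_le.mp (k w.1.1 w.2.2 v.1.1 v.2.2)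
  have h2 := abs_le.mp (k w.1.2 w.2.1 v.1.2 v.2.1)
  have h3 := abs_le.mp (k w.1.1 w.2.1 v.1.1 v.2.1)
  have h4 := abs_le.mp (k w.1.2 w.2.2 v.1.2 v.2.2)
  rw [abs_le]; constructor <;> linarith [h1.1, h1.2, h2.1, h2.2, h3.1, h3.2, h4.1, h4.2]

lemma add4 {Ω : Type*} [MeasurableSpace Ω] {μ : Measure Ω} {f1 f2 f3 f4 : Ω → ℝ}
    (h1 : Integrable f1 μ) (h2 : Integrable f2 μ) (h3 : Integrable f3 μ) (h4 : Integrable f4 μ) :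
    Integrable (fun w => f1 w + f2 w + f3 w + f4 w) μ ∧
    ∫ w, (f1 w + f2 w + f3 w + f4 w) ∂μ =
      ∫ w, f1 w ∂μ + ∫ w, f2 w ∂μ + ∫ w, f3 w ∂μ + ∫ w, f4 w ∂μ := by
  have h12 : Integrable (fun w => f1 w + f2 w) μ := h1.add h2
  have h123 : Integrable (fun w => f1 w + f2 w + f3 w) μ := h12.add h3
  refine ⟨h123.add h4, ?_⟩
  rw [integral_add h123 h4, integral_add h12 h3, integral_add h1 h2]

lemma mgf_large (a b : ℝ≥0) (l : ℝ) (hl : |l| ≤ 1/8) :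
    ∫ w, Real.exp (l * phi w) ∂(QQ a b) ≤ Real.exp (l * DD a b + 400 * l^2 * (a + b)) := by
  set E1 := ∫ w, Real.exp (l * phi w) ∂(QQ a b) with hE1
  set E2 := ∫ w, Real.exp (-l * phi w) ∂(QQ a b) with hE2
  obtain ⟨pi, pv⟩ := phi_integral a b
  have jen : Real.exp (-l * DD a b) ≤ E2 := by
    have i0 : Integrable (fun w => -l * phi w) (QQ a b) := pi.const_mul _
    have h := convexOn_exp.map_integral_le (μ := QQ a b) (f := fun w => -l * phi w)
      Real.continuous_exp.continuousOn isClosed_univ (by simp) i0 (phi_exp_integrable a b (-l))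
    rw [integral_const_mul, pv] at h
    exact h
  have E10 : 0 ≤ E1 := integral_nonneg fun w => (Real.exp_pos _).le
  have m1 : MeasurePreserving (Prod.fst : ℕ × ℕ → ℕ) (nu a b) (poissonMeasure a) :=
    measurePreserving_fst
  have m2 : MeasurePreserving (Prod.snd : ℕ × ℕ → ℕ) (nu a b) (poissonMeasure b) :=
    measurePreserving_snd
  have n1 : MeasurePreserving Prod.fst (QQ a b) (nu a b) := measurePreserving_fst
  have n2 : MeasurePreserving Prod.snd (QQ a b) (nu a b) := measurePreserving_snd
  have c1 := sym_coord (m1.comp n1)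
  have c2 := sym_coord (m2.comp n1)
  have c3 := sym_coord (m1.comp n2)
  have c4 := sym_coord (m2.comp n2)
  have bd : ∀ u : ℝ≥0, u ≤ a + b → ∀ c : ℝ, c = 8 * l ∨ c = -(8*l) →
      Real.exp (u * (Real.exp c + Real.exp (-c) - 2)) ≤ Real.exp (400 * l^2 * (a + b)) := by
    intro u hu c hc
    rw [Real.exp_le_exp]
    have hc1 : |c| ≤ 1 := by
      rcases hc with rfl | rfl <;> simp [abs_mul] <;> linarith
    have hc2 : c^2 = 64 * l^2 := by rcases hc with rfl | rfl <;> ring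
    have h1 := exp_bound2 hc1
    have h2 := exp_bound2 (t := -c) (by rwa [abs_neg])
    have hu' : (u:ℝ) ≤ a + b := by exact_mod_cast hu
    calc (u:ℝ) * (Real.exp c + Real.exp (-c) - 2) ≤ u * (128 * l^2) := by gcongr; nlinarith
      _ ≤ (a + b) * (128 * l^2) := by gcongr
      _ ≤ _ := by nlinarith [show 0 ≤ ((a:ℝ) + b) * l^2 by positivity]
  have ie : ∀ c d : ℝ, Integrable (fun v : ((ℕ × ℕ) × (ℕ × ℕ)) × ((ℕ × ℕ) × (ℕ × ℕ)) =>
      Real.exp (c * phi v.1) * Real.exp (d * phi v.2)) ((QQ a b).prod (QQ a b)) := fun c d =>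
    (phi_exp_integrable a b c).mul_prod (phi_exp_integrable a b d)
  have key : E1 * E2 ≤ Real.exp (400 * l^2 * (a + b)) := by
    have s1 : ∫ v, Real.exp (l * phi v.1) * Real.exp (-l * phi v.2) ∂((QQ a b).prod (QQ a b)) = E1 * E2 :=
      integral_prod_mul (fun w => Real.exp (l * phi w)) (fun w => Real.exp (-l * phi w))
    have s2 : ∫ v, Real.exp (-l * phi v.1) * Real.exp (l * phi v.2) ∂((QQ a b).prod (QQ a b)) = E2 * E1 :=
      integral_prod_mul (fun w => Real.exp (-l * phi w)) (fun w => Real.exp (l * phi w))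
    have s3 := integral_add (ie l (-l)) (ie (-l) l)
    rw [s1, s2] at s3
    set H : ℝ → (((ℕ × ℕ) × (ℕ × ℕ)) × ((ℕ × ℕ) × (ℕ × ℕ))) → ℝ := fun c v =>
      Real.exp (c * ((v.1.1.1:ℝ) - v.2.1.1)) + Real.exp (c * ((v.1.1.2:ℝ) - v.2.1.2)) +
      Real.exp (c * ((v.1.2.1:ℝ) - v.2.2.1)) + Real.exp (c * ((v.1.2.2:ℝ) - v.2.2.2)) with hH
    have Hi : ∀ c, Integrable (H c) ((QQ a b).prod (QQ a b)) := fun c =>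
      (((c1 c).1.add (c2 c).1).add (c3 c).1).add (c4 c).1
    have Hv : ∀ c, c = 8 * l ∨ c = -(8*l) → ∫ v, H c v ∂((QQ a b).prod (QQ a b)) ≤
        4 * Real.exp (400 * l^2 * (a + b)) := fun c hc => by
      have e := (add4 (c1 c).1 (c2 c).1 (c3 c).1 (c4 c).1).2
      rw [(c1 c).2, (c2 c).2, (c3 c).2, (c4 c).2] at e
      have ba := bd a (by simp) c hc
      have bb := bd b (by simp) c hc
      refine le_trans (le_of_eq e) ?_
      linarith
    have fin : ∫ v, (Real.exp (l * phi v.1) * Real.exp (-l * phi v.2) +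
        Real.exp (-l * phi v.1) * Real.exp (l * phi v.2)) ∂((QQ a b).prod (QQ a b)) ≤
        ∫ v, (1/4) * (H (8*l) v + H (-(8*l)) v) ∂((QQ a b).prod (QQ a b)) := by
      refine integral_mono ((ie l (-l)).add (ie (-l) l)) (((Hi _).add (Hi _)).const_mul _) fun v => ?_
      have hl' := phi_lip v.1 v.2
      have := cosh_bd (l * (phi v.1 - phi v.2)) (8 * l * ((v.1.1.1:ℝ) - v.2.1.1))
        (8 * l * ((v.1.1.2:ℝ) - v.2.1.2)) (8 * l * ((v.1.2.1:ℝ) - v.2.2.1))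
        (8 * l * ((v.1.2.2:ℝ) - v.2.2.2)) (by
          simp only [abs_mul]
          have := mul_le_mul_of_nonneg_left hl' (abs_nonneg l)
          refine this.trans (le_of_eq ?_)
          norm_num
          ring)
      simp only [hH, ← Real.exp_add]
      have t1 : l * phi v.1 + -l * phi v.2 = l * (phi v.1 - phi v.2) := by ring
      have t2 : -l * phi v.1 + l * phi v.2 = -(l * (phi v.1 - phi v.2)) := by ring
      rw [t1, t2]
      simp only [neg_mul]
      linarith
    rw [integral_const_mul, integral_add (Hi _) (Hi _)] at fin
    have h1 := Hv (8*l) (Or.inl rfl)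
    have h2 := Hv (-(8*l)) (Or.inr rfl)
    have h3 := s3.symm.trans_le fin
    nlinarith
  have hpos := Real.exp_pos (-l * DD a b)
  have : E1 * Real.exp (-l * DD a b) ≤ Real.exp (400 * l^2 * (a + b)) :=
    (mul_le_mul_of_nonneg_left jen E10).trans key
  rw [show l * DD a b + 400 * l^2 * ((a:ℝ) + b) = 400 * l^2 * (a + b) - (-l * DD a b) by ring, Real.exp_sub,
    le_div_iff₀ hpos]
  exact this


lemma mgf_min (a b : ℝ≥0) (l : ℝ) (hl : |l| ≤ 1/8) :
    ∫ w, Real.exp (l * phi w) ∂(QQ a b) ≤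
      Real.exp (l * DD a b + 400 * l^2 * min ((a:ℝ) + b) ((a + b)^2)) := by
  have h0 : (0:ℝ) ≤ a + b := by positivity
  rcases le_total ((a:ℝ) + b) 1 with h | h
  · rw [min_eq_right (by nlinarith)]; exact mgf_small a b l hl h
  · rw [min_eq_left (by nlinarith)]; exact mgf_large a b l hl

lemma mgf_null (b : ℝ≥0) (l : ℝ) (hl : |l| ≤ 1/8) :
    ∫ w, Real.exp (l * phi w) ∂(QQ b b) ≤ Real.exp (1600 * l^2 * min (b:ℝ) (b^2)) := by
  refine (mgf_min b b l hl).trans ?_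
  rw [Real.exp_le_exp]
  have h : min ((b:ℝ) + b) ((b + b)^2) ≤ 4 * min (b:ℝ) (b^2) := by
    have := b.coe_nonneg
    rcases min_cases (b:ℝ) (b^2) with ⟨e, _⟩ | ⟨e, _⟩ <;> rw [e]
    · exact (min_le_left _ _).trans (by linarith)
    · exact (min_le_right _ _).trans (by nlinarith)
  have e : DD b b = 0 := by unfold DD; ring
  rw [e]
  have := mul_le_mul_of_nonneg_left h (show 0 ≤ 400 * l^2 by positivity)
  linarith

lemma DD_symm (a b : ℝ≥0) : DD a b = DD b a := by unfold DD; rw [ee_symm a b]; ring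

lemma DD_ge (a b : ℝ≥0) :
    (1/2592) * (|(a:ℝ) - b|^2 / (|(a:ℝ) - b| + Real.sqrt (1 + b))) ≤ DD a b := by
  have hb := b.coe_nonneg
  have ha := a.coe_nonneg
  rcases le_total b a with h | h
  · obtain ⟨d, rfl⟩ := exists_add_of_le h
    rw [DD_symm]
    have := DD_lower b d
    simpa using this
  · obtain ⟨d, rfl⟩ := exists_add_of_le h
    refine le_trans ?_ (DD_lower a d)
    have e : |(a:ℝ) - (a + d : ℝ≥0)| = d := by push_cast; simp
    rw [e]
    have h1 : 1 ≤ Real.sqrt (1 + a) := Real.one_le_sqrt.mpr (by linarith)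
    have : (a:ℝ) ≤ (a + d : ℝ≥0) := by exact_mod_cast h
    gcongr

lemma DD_nonneg (a b : ℝ≥0) : 0 ≤ DD a b := le_trans (by positivity) (DD_ge a b)

lemma mgf_alt (a b : ℝ≥0) (l : ℝ) (hl : 0 ≤ l) (hl1 : l ≤ 1/60000000) :
    ∫ w, Real.exp (-l * phi w) ∂(QQ a b) ≤
      Real.exp (- l * DD a b / 2 + 3600 * l^2 * min (b:ℝ) (b^2)) := by
  refine (mgf_min a b (-l) (by rw [abs_neg, abs_of_nonneg hl]; linarith)).trans ?_
  rw [Real.exp_le_exp]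
  have hb := b.coe_nonneg
  have ha := a.coe_nonneg
  have hD := DD_nonneg a b
  have hm : 0 ≤ min (b:ℝ) (b^2) := le_min hb (by positivity)
  rcases le_total (a:ℝ) (2 * b) with h | h
  · have h1 : min ((a:ℝ) + b) ((a + b)^2) ≤ 9 * min (b:ℝ) (b^2) := by
      rcases min_cases (b:ℝ) (b^2) with ⟨e, _⟩ | ⟨e, _⟩ <;> rw [e]
      · exact (min_le_left _ _).trans (by linarith)
      · refine (min_le_right _ _).trans ?_
        nlinarith
    have := mul_le_mul_of_nonneg_left h1 (show 0 ≤ 400 * l^2 by positivity)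
    nlinarith
  · set d := (a:ℝ) - b with hd
    have hd0 : 0 ≤ d := by linarith
    have hbd : (b:ℝ) ≤ d := by linarith
    have h1 : min ((a:ℝ) + b) ((a + b)^2) ≤ 9 * min d (d^2) := by
      rcases min_cases d (d^2) with ⟨e, _⟩ | ⟨e, _⟩ <;> rw [e]
      · exact (min_le_left _ _).trans (by linarith)
      · refine (min_le_right _ _).trans ?_
        nlinarith
    have h2 := DD_ge a b
    rw [← hd, abs_of_nonneg hd0] at h2
    have h3 : min d (d^2) / 3 ≤ d^2 / (d + Real.sqrt (1 + b)) := by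
      have hs : Real.sqrt (1 + b) ≤ 1 + d := by
        rw [Real.sqrt_le_left (by linarith)]; nlinarith
      have hs1 : 1 ≤ Real.sqrt (1 + b) := Real.one_le_sqrt.mpr (by linarith)
      rw [div_le_div_iff₀ (by norm_num) (by linarith)]
      rcases min_cases d (d^2) with ⟨e, h⟩ | ⟨e, h⟩ <;> rw [e]
      · nlinarith
      · have : d ≤ 1 := by nlinarith
        nlinarith [sq_nonneg d]
    have hmd : 0 ≤ min d (d^2) := le_min hd0 (by positivity)
    have h4 : min d (d^2) ≤ 7776 * DD a b := by linarith
    have h5 : 400 * (-l)^2 * min ((a:ℝ) + b) ((a + b)^2) ≤ l * DD a b / 2 := by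
      calc 400 * (-l)^2 * min ((a:ℝ) + b) ((a + b)^2) ≤ 400 * (-l)^2 * (9 * (7776 * DD a b)) := by
            gcongr; linarith
        _ = (l * DD a b) * (27993600 * l) := by ring
        _ ≤ (l * DD a b) * (27993600 * (1/60000000)) := by gcongr
        _ ≤ _ := by nlinarith [mul_nonneg hl hD]
    have : 0 ≤ 3600 * l^2 * min (b:ℝ) (b^2) := by positivity
    linarith

noncomputable def po (a : ℝ) (n : ℕ) : ℝ := Real.exp (-a) * a ^ n / (n.factorial : ℝ)

lemma po_nonneg {a : ℝ} (ha : 0 ≤ a) (n : ℕ) : 0 ≤ po a n := by unfold po; positivity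

lemma box_le (a b : ℝ≥0) (g : (ℕ × ℕ) × (ℕ × ℕ) → ℝ) (hg : Integrable g (QQ a b)) (h0 : ∀ w, 0 ≤ g w)
    (S : Finset ((ℕ × ℕ) × (ℕ × ℕ))) :
    ∑ w ∈ S, (po a w.1.1 * po b w.1.2) * (po a w.2.1 * po b w.2.2) * g w ≤ ∫ w, g w ∂(QQ a b) := by
  have h1 : ∫ w in (S : Set ((ℕ × ℕ) × (ℕ × ℕ))), g w ∂(QQ a b) ≤ ∫ w, g w ∂(QQ a b) :=
    setIntegral_le_integral hg (by filter_upwards with w; exact h0 w)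
  rw [setIntegral_finset (hf := hg.integrableOn)] at h1
  refine le_trans (le_of_eq ?_) h1
  refine Finset.sum_congr rfl fun w _ => ?_
  have e1 : ∀ z : ℕ × ℕ, (nu a b).real {z} = po a z.1 * po b z.2 := fun z => by
    have : ({z} : Set (ℕ × ℕ)) = {z.1} ×ˢ {z.2} := by simp
    rw [this, nu, measureReal_prod_prod, poissonMeasure_real_singleton, poissonMeasure_real_singleton]
    rfl
  have : ({w} : Set ((ℕ × ℕ) × (ℕ × ℕ))) = {w.1} ×ˢ {w.2} := by simp
  rw [this, QQ, measureReal_prod_prod, e1, e1, smul_eq_mul]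

lemma box1_le (a : ℝ≥0) (g : ℕ → ℝ) (hg : Integrable g (poissonMeasure a)) (h0 : ∀ w, 0 ≤ g w)
    (S : Finset ℕ) :
    ∑ w ∈ S, po a w * g w ≤ ∫ w, g w ∂(poissonMeasure a) := by
  have h1 : ∫ w in (S : Set ℕ), g w ∂(poissonMeasure a) ≤ ∫ w, g w ∂(poissonMeasure a) :=
    setIntegral_le_integral hg (by filter_upwards with w; exact h0 w)
  rw [setIntegral_finset (hf := hg.integrableOn)] at h1
  refine le_trans (le_of_eq ?_) h1
  refine Finset.sum_congr rfl fun w _ => ?_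
  rw [poissonMeasure_real_singleton]; rfl


section tp
variable {T : Type*} [Fintype T] [DecidableEq T]

/-- the counts of a sequence of tokens -/
def cnt {M : ℕ} (x : Fin M → T) : T → ℕ := fun τ => (Finset.univ.filter fun i => x i = τ).card

lemma cnt_sum {M : ℕ} (x : Fin M → T) : ∑ τ, cnt x τ = M := by
  unfold cnt
  rw [← Finset.card_eq_sum_card_fiberwise (f := x) (s := Finset.univ) (t := Finset.univ) (by simp)]
  simp

lemma tp_level (M : ℕ) (w : T → ℝ) (f : (T → ℕ) → ℝ) :
    ∑ x : Fin M → T, (∏ i, w (x i)) * f (cnt x) =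
      ∑ N ∈ Finset.piAntidiag Finset.univ M, (Nat.multinomial Finset.univ N : ℝ) * (∏ τ, w τ ^ N τ) * f N := by
  classical
  set L : MvPolynomial T ℝ →ₗ[ℝ] ℝ := (MvPolynomial.basisMonomials T ℝ).constr ℝ (fun N => f ⇑N) with hL
  have hLm : ∀ (N : T →₀ ℕ) (c : ℝ), L (MvPolynomial.monomial N c) = c * f ⇑N := by
    intro N c
    have : MvPolynomial.monomial N c = c • MvPolynomial.basisMonomials T ℝ N := by
      simp [MvPolynomial.smul_monomial]
    rw [this, map_smul, hL, Module.Basis.constr_basis]; rfl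
  have mono : ∀ N : T → ℕ, ∏ τ, (MvPolynomial.X τ : MvPolynomial T ℝ) ^ N τ =
      MvPolynomial.monomial (Finsupp.equivFunOnFinite.symm N) 1 := by
    intro N
    rw [MvPolynomial.monomial_eq]
    simp [Finsupp.prod_fintype]
  have e1 : (∑ τ, MvPolynomial.C (w τ) * (MvPolynomial.X τ : MvPolynomial T ℝ)) ^ M =
      ∑ x : Fin M → T, ∏ i, MvPolynomial.C (w (x i)) * (MvPolynomial.X (x i) : MvPolynomial T ℝ) := by
    rw [Finset.sum_pow']
    simp
  have e2 := Finset.sum_pow_eq_sum_piAntidiag (Finset.univ : Finset T)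
    (fun τ => MvPolynomial.C (w τ) * (MvPolynomial.X τ : MvPolynomial T ℝ)) M
  have e3 := congrArg L (e1.symm.trans e2)
  rw [map_sum, map_sum] at e3
  convert e3 using 1
  · refine Finset.sum_congr rfl fun x _ => ?_
    have : ∏ i, MvPolynomial.C (w (x i)) * (MvPolynomial.X (x i) : MvPolynomial T ℝ) =
        MvPolynomial.monomial (Finsupp.equivFunOnFinite.symm (cnt x)) (∏ i, w (x i)) := by
      rw [Finset.prod_mul_distrib, ← map_prod]
      have : ∏ i, (MvPolynomial.X (x i) : MvPolynomial T ℝ) = ∏ τ, (MvPolynomial.X τ) ^ cnt x τ := by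
        rw [← Finset.prod_fiberwise' Finset.univ x (fun τ => (MvPolynomial.X τ : MvPolynomial T ℝ))]
        simp [cnt]
      rw [this, mono, MvPolynomial.C_mul_monomial, mul_one]
    rw [this, hLm]; rfl
  · refine Finset.sum_congr rfl fun N _ => ?_
    simp only [mul_pow]
    rw [Finset.prod_mul_distrib, mono]
    simp only [← map_pow]
    rw [← map_prod, MvPolynomial.C_mul_monomial, mul_one]
    have : (Nat.multinomial Finset.univ N : MvPolynomial T ℝ) = MvPolynomial.C (Nat.multinomial Finset.univ N : ℝ) := by
      simp
    rw [this, MvPolynomial.C_mul_monomial, hLm]; rfl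

noncomputable def TP (K : ℕ) (μ : ℝ) (w : T → ℝ) (f : (T → ℕ) → ℝ) : ℝ :=
  ∑ M ∈ Finset.range (K + 1), po μ M * ∑ x : Fin M → T, (∏ i, w (x i)) * f (cnt x)

lemma TP_eq (K : ℕ) (μ : ℝ) (w : T → ℝ) (hw : ∑ τ, w τ = 1) (f : (T → ℕ) → ℝ) :
    TP K μ w f = ∑ M ∈ Finset.range (K + 1), ∑ N ∈ Finset.piAntidiag Finset.univ M,
      (∏ τ, po (μ * w τ) (N τ)) * f N := by
  unfold TP
  refine Finset.sum_congr rfl fun M _ => ?_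
  rw [tp_level, Finset.mul_sum]
  refine Finset.sum_congr rfl fun N hN => ?_
  rw [Finset.mem_piAntidiag] at hN
  rw [← mul_assoc]; congr 1
  have hm := Nat.multinomial_spec Finset.univ N
  rw [hN.1] at hm
  have hm' : (∏ τ, ((N τ).factorial : ℝ)) * (Nat.multinomial Finset.univ N : ℝ) = (M.factorial : ℝ) := by
    exact_mod_cast hm
  unfold po
  rw [Finset.prod_div_distrib, Finset.prod_mul_distrib, ← Real.exp_sum]
  have e1 : ∑ τ, -(μ * w τ) = -μ := by
    rw [Finset.sum_neg_distrib, ← Finset.mul_sum, hw, mul_one]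
  simp only [mul_pow]
  rw [e1, Finset.prod_mul_distrib, Finset.prod_pow_eq_pow_sum, hN.1, ← hm']
  have h1 : (∏ τ, ((N τ).factorial : ℝ)) ≠ 0 := Finset.prod_ne_zero_iff.mpr fun τ _ => by positivity
  have h2 : (Nat.multinomial Finset.univ N : ℝ) ≠ 0 := by
    intro h; rw [h, mul_zero] at hm'
    exact (show (M.factorial : ℝ) ≠ 0 by positivity) hm'.symm
  field_simp

lemma TP_mono (K : ℕ) {μ : ℝ} (hμ : 0 ≤ μ) {w : T → ℝ} (hw : ∀ τ, 0 ≤ w τ) {f g : (T → ℕ) → ℝ}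
    (h : ∀ N : T → ℕ, ∑ τ, N τ ≤ K → f N ≤ g N) : TP K μ w f ≤ TP K μ w g := by
  unfold TP
  refine Finset.sum_le_sum fun M hM => ?_
  refine mul_le_mul_of_nonneg_left ?_ (po_nonneg hμ M)
  refine Finset.sum_le_sum fun x _ => ?_
  refine mul_le_mul_of_nonneg_left ?_ (Finset.prod_nonneg fun i _ => hw _)
  apply h
  rw [cnt_sum]
  have := Finset.mem_range.mp hM
  omega

lemma TP_add (K : ℕ) (μ : ℝ) (w : T → ℝ) (f g : (T → ℕ) → ℝ) :
    TP K μ w (fun N => f N + g N) = TP K μ w f + TP K μ w g := by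
  unfold TP
  simp only [mul_add, Finset.sum_add_distrib]

lemma TP_sub (K : ℕ) (μ : ℝ) (w : T → ℝ) (f g : (T → ℕ) → ℝ) :
    TP K μ w (fun N => f N - g N) = TP K μ w f - TP K μ w g := by
  unfold TP
  simp only [mul_sub, Finset.sum_sub_distrib]

lemma TP_smul (K : ℕ) (μ : ℝ) (w : T → ℝ) (c : ℝ) (f : (T → ℕ) → ℝ) :
    TP K μ w (fun N => c * f N) = c * TP K μ w f := by
  unfold TP
  simp only [Finset.mul_sum]
  refine Finset.sum_congr rfl fun M _ => Finset.sum_congr rfl fun x _ => ?_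
  ring

lemma TP_one (K : ℕ) (μ : ℝ) (w : T → ℝ) (hw : ∑ τ, w τ = 1) :
    TP K μ w (fun _ => 1) = ∑ M ∈ Finset.range (K + 1), po μ M := by
  unfold TP
  refine Finset.sum_congr rfl fun M _ => ?_
  have : ∑ x : Fin M → T, (∏ i, w (x i)) = 1 := by
    have := Finset.sum_pow' (Finset.univ : Finset T) w M
    simp only [Fintype.piFinset_univ] at this
    rw [← this, hw, one_pow]
  simp [this]

lemma po_sum_le (K : ℕ) {μ : ℝ} (hμ : 0 ≤ μ) : ∑ M ∈ Finset.range (K + 1), po μ M ≤ 1 := by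
  have := box1_le μ.toNNReal (fun _ => 1) (integrable_const _) (fun _ => zero_le_one) (Finset.range (K+1))
  simpa [hμ] using this

lemma po_sum_ge (K : ℕ) : 1 - Real.exp (-K/2) ≤ ∑ M ∈ Finset.range (K + 1), po (K/4) M := by
  set a : ℝ≥0 := K/4 with ha
  have hac : (a:ℝ) = K/4 := by rw [ha]; push_cast; rfl
  have e : ∑ M ∈ Finset.range (K + 1), po (K/4) M = (poissonMeasure a).real (Finset.range (K+1)) := by
    rw [← integral_indicator_one (MeasurableSet.of_discrete), integral_indicator MeasurableSet.of_discrete,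
      setIntegral_finset (hf := (by exact (integrable_const (1:ℝ)).integrableOn))]
    refine Finset.sum_congr rfl fun M _ => ?_
    rw [poissonMeasure_real_singleton, hac]; simp [po]
  have h1 := po_real_le (a := a) (A := (↑(Finset.range (K+1)) : Set ℕ)ᶜ)
    ((po_exp_integrable a 1).const_mul (Real.exp (-K))) (fun n => by positivity) (fun n hn => by
      rw [← Real.exp_add]
      apply Real.one_le_exp
      simp only [Finset.coe_range, Set.mem_compl_iff, Set.mem_Iio, not_lt] at hn
      have : (K:ℝ) + 1 ≤ n := by exact_mod_cast hn
      linarith)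
  rw [measureReal_compl MeasurableSet.of_discrete, probReal_univ, ← e, integral_const_mul,
    po_exp_integral, ← Real.exp_add] at h1
  have h2 : Real.exp (-K + a * (Real.exp 1 - 1)) ≤ Real.exp (-K/2) := by
    rw [Real.exp_le_exp, hac]
    have := Real.exp_one_lt_d9
    have : (0:ℝ) ≤ K := by positivity
    nlinarith
  linarith

lemma TP_le_box (K : ℕ) {μ : ℝ} (hμ : 0 ≤ μ) {w : T → ℝ} (hw0 : ∀ τ, 0 ≤ w τ) (hw : ∑ τ, w τ = 1)
    (f : (T → ℕ) → ℝ) (hf : ∀ N, 0 ≤ f N) :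
    TP K μ w f ≤ ∑ N ∈ Fintype.piFinset (fun _ : T => Finset.range (K+1)), (∏ τ, po (μ * w τ) (N τ)) * f N := by
  rw [TP_eq K μ w hw, ← Finset.sum_biUnion]
  · refine Finset.sum_le_sum_of_subset_of_nonneg ?_ fun N _ _ =>
      mul_nonneg (Finset.prod_nonneg fun τ _ => po_nonneg (mul_nonneg hμ (hw0 τ)) _) (hf N)
    intro N hN
    simp only [Finset.mem_biUnion, Finset.mem_range, Finset.mem_piAntidiag] at hN
    obtain ⟨M, hM, hN, _⟩ := hN
    rw [Fintype.mem_piFinset]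
    intro τ
    have : N τ ≤ Finset.univ.sum N := Finset.single_le_sum (f := N) (fun i _ => Nat.zero_le _) (Finset.mem_univ τ)
    rw [Finset.mem_range]; omega
  · intro M _ M' _ hne
    simp only [Function.onFun]
    rw [Finset.disjoint_left]
    intro N h1 h2
    rw [Finset.mem_piAntidiag] at h1 h2
    exact hne (h1.1.symm.trans h2.1)

/-- product bound, one dimensional factors -/
lemma TP_le_prod (K : ℕ) {μ : ℝ} (hμ : 0 ≤ μ) {w : T → ℝ} (hw0 : ∀ τ, 0 ≤ w τ) (hw : ∑ τ, w τ = 1)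
    (g : T → ℕ → ℝ) (hg0 : ∀ τ n, 0 ≤ g τ n) (B : T → ℝ)
    (hB : ∀ τ, Integrable (g τ) (poissonMeasure (μ * w τ).toNNReal) ∧
      ∫ n, g τ n ∂(poissonMeasure (μ * w τ).toNNReal) ≤ B τ) :
    TP K μ w (fun N => ∏ τ, g τ (N τ)) ≤ ∏ τ, B τ := by
  refine (TP_le_box K hμ hw0 hw _ fun N => Finset.prod_nonneg fun τ _ => hg0 _ _).trans ?_
  simp only [← Finset.prod_mul_distrib]
  rw [← Finset.prod_univ_sum (fun _ : T => Finset.range (K+1)) (fun τ n => po (μ * w τ) n * g τ n)]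
  refine Finset.prod_le_prod (fun τ _ => Finset.sum_nonneg fun n _ =>
    mul_nonneg (po_nonneg (mul_nonneg hμ (hw0 τ)) _) (hg0 _ _)) fun τ _ => ?_
  have := box1_le _ (g τ) (hB τ).1 (hg0 τ) (Finset.range (K+1))
  rw [Real.coe_toNNReal _ (mul_nonneg hμ (hw0 τ))] at this
  exact this.trans (hB τ).2
end tp

/-- rearrangement of four counts into the shape used by `phi` -/
def quad (v : Fin 4 → ℕ) : (ℕ × ℕ) × (ℕ × ℕ) := ((v 0, v 3), (v 1, v 2))

lemma quad_inj : Function.Injective quad := by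
  intro v v' h
  simp only [quad, Prod.mk.injEq] at h
  funext i
  fin_cases i <;> simp [h]

lemma TP_le_prod4 {β : Type*} [Fintype β] [DecidableEq β] (K : ℕ) {μ : ℝ} (hμ : 0 ≤ μ)
    {w : β × Fin 4 → ℝ} (hw0 : ∀ τ, 0 ≤ w τ) (hw : ∑ τ, w τ = 1)
    (a b : β → ℝ≥0) (ha0 : ∀ t, μ * w (t, 0) = a t) (ha1 : ∀ t, μ * w (t, 1) = a t)
    (hb2 : ∀ t, μ * w (t, 2) = b t) (hb3 : ∀ t, μ * w (t, 3) = b t)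
    (g : (ℕ × ℕ) × (ℕ × ℕ) → ℝ) (hg0 : ∀ z, 0 ≤ g z) (B : β → ℝ)
    (hB : ∀ t, Integrable g (QQ (a t) (b t)) ∧ ∫ z, g z ∂(QQ (a t) (b t)) ≤ B t) :
    TP K μ w (fun N => ∏ t, g (quad fun i => N (t, i))) ≤ ∏ t, B t := by
  refine (TP_le_box K hμ hw0 hw _ fun N => Finset.prod_nonneg fun τ _ => hg0 _).trans ?_
  have e : ∑ N ∈ Fintype.piFinset (fun _ : β × Fin 4 => Finset.range (K+1)),
        (∏ τ, po (μ * w τ) (N τ)) * ∏ t, g (quad fun i => N (t, i)) =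
      ∑ V ∈ Fintype.piFinset (fun _ : β => Fintype.piFinset (fun _ : Fin 4 => Finset.range (K+1))),
        ∏ t, ((po (a t) (quad (V t)).1.1 * po (b t) (quad (V t)).1.2) *
          (po (a t) (quad (V t)).2.1 * po (b t) (quad (V t)).2.2) * g (quad (V t))) := by
    refine Finset.sum_equiv (Equiv.curry β (Fin 4) ℕ) ?_ ?_
    · intro N
      simp [Fintype.mem_piFinset, Prod.forall]
    · intro N _
      rw [Fintype.prod_prod_type, ← Finset.prod_mul_distrib]
      refine Finset.prod_congr rfl fun t _ => ?_
      rw [Fin.prod_univ_four, ha0, ha1, hb2, hb3]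
      simp only [quad, Equiv.curry_apply, Function.curry_apply]
      ring
  rw [e, ← Finset.prod_univ_sum (fun _ : β => Fintype.piFinset (fun _ : Fin 4 => Finset.range (K+1)))
    (fun t v => (po (a t) (quad v).1.1 * po (b t) (quad v).1.2) *
          (po (a t) (quad v).2.1 * po (b t) (quad v).2.2) * g (quad v))]
  refine Finset.prod_le_prod (fun t _ => Finset.sum_nonneg fun n _ => ?_) fun t _ => ?_
  · have := hg0 (quad n)
    have h1 := fun n => po_nonneg (a t).coe_nonneg n
    have h2 := fun n => po_nonneg (b t).coe_nonneg n
    exact mul_nonneg (mul_nonneg (mul_nonneg (h1 _) (h2 _)) (mul_nonneg (h1 _) (h2 _))) this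
  · have := box_le (a t) (b t) g (hB t).1 hg0
      ((Fintype.piFinset (fun _ : Fin 4 => Finset.range (K+1))).map ⟨quad, quad_inj⟩)
    rw [Finset.sum_map] at this
    exact this.trans (hB t).2


section ach
variable {α : Type*} [Fintype α]

/-- `h p` is the acceptance probability of some tester with `k` samples -/
def Ach (k : ℕ) (h : (α → ℝ) → ℝ) : Prop :=
  ∃ A : (Fin k → α) → ℝ, (∀ x, 0 ≤ A x ∧ A x ≤ 1) ∧ ∀ p, IsPMF p → acceptProb1 p A = h p

lemma Ach_congr {k : ℕ} {h h' : (α → ℝ) → ℝ} (H : Ach k h) (e : ∀ p, IsPMF p → h p = h' p) : Ach k h' := by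
  obtain ⟨A, hA, hp⟩ := H
  exact ⟨A, hA, fun p hpp => (hp p hpp).trans (e p hpp)⟩

lemma Ach_const (c : ℝ) (h0 : 0 ≤ c) (h1 : c ≤ 1) : Ach (α := α) 0 (fun _ => c) :=
  ⟨fun _ => c, fun _ => ⟨h0, h1⟩, fun p _ => by simp [acceptProb1]⟩

lemma Ach_succ {k : ℕ} {h : α → (α → ℝ) → ℝ} (H : ∀ x, Ach k (h x)) :
    Ach (k + 1) (fun p => ∑ x, p x * h x p) := by
  choose A hA hp using H
  refine ⟨fun z => A (z 0) (Fin.tail z), fun z => hA _ _, fun p hpp => ?_⟩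
  unfold acceptProb1
  rw [← (Fin.consEquiv (fun _ : Fin (k+1) => α)).sum_comp, Fintype.sum_prod_type]
  refine Finset.sum_congr rfl fun x _ => ?_
  rw [← hp x p hpp, acceptProb1, Finset.mul_sum]
  refine Finset.sum_congr rfl fun z _ => ?_
  simp [Fin.consEquiv, Fin.prod_univ_succ, mul_assoc]

lemma Ach_mono {k k' : ℕ} (hk : k ≤ k') {h : (α → ℝ) → ℝ} (H : Ach k h) : Ach k' h := by
  induction hk with
  | refl => exact H
  | step _ ih =>
    refine Ach_congr (Ach_succ fun _ => ih) fun p hp => ?_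
    rw [← Finset.sum_mul, hp.2, one_mul]

lemma Ach_comb {ι : Type*} (s : Finset ι) {k : ℕ} {h : ι → (α → ℝ) → ℝ} (c : ι → ℝ)
    (hc : ∀ i ∈ s, 0 ≤ c i) (hc1 : ∑ i ∈ s, c i ≤ 1) (H : ∀ i ∈ s, Ach k (h i)) :
    Ach k (fun p => ∑ i ∈ s, c i * h i p) := by
  choose! A hA hp using H
  refine ⟨fun x => ∑ i ∈ s, c i * A i x, fun x => ⟨?_, ?_⟩, fun p hpp => ?_⟩
  · exact Finset.sum_nonneg fun i hi => mul_nonneg (hc i hi) (hA i hi x).1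
  · refine le_trans (Finset.sum_le_sum fun i hi => ?_) hc1
    exact mul_le_of_le_one_right (hc i hi) (hA i hi x).2
  · unfold acceptProb1
    simp only [Finset.mul_sum]
    rw [Finset.sum_comm]
    refine Finset.sum_congr rfl fun i hi => ?_
    rw [← hp i hi p hpp, acceptProb1, Finset.mul_sum]
    refine Finset.sum_congr rfl fun z _ => ?_
    ring

variable {T : Type*} [Fintype T]

/-- distribution of a token produced from two samples -/
noncomputable def tok (W : α → α → T → ℝ) (p : α → ℝ) (τ : T) : ℝ := ∑ x, p x * ∑ y, p y * W x y τ

lemma tok_nonneg {W : α → α → T → ℝ} (hW : ∀ x y τ, 0 ≤ W x y τ) {p : α → ℝ} (hp : IsPMF p) (τ : T) :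
    0 ≤ tok W p τ :=
  Finset.sum_nonneg fun x _ => mul_nonneg (hp.1 x) (Finset.sum_nonneg fun y _ => mul_nonneg (hp.1 y) (hW _ _ _))

lemma tok_sum {W : α → α → T → ℝ} (hW : ∀ x y, ∑ τ, W x y τ = 1) {p : α → ℝ} (hp : IsPMF p) :
    ∑ τ, tok W p τ = 1 := by
  unfold tok
  rw [Finset.sum_comm]
  simp only [← Finset.mul_sum]
  have : ∀ x, ∑ τ, ∑ y, p y * W x y τ = 1 := fun x => by
    rw [Finset.sum_comm]
    simp only [← Finset.mul_sum, hW, mul_one, hp.2]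
  simp [this, hp.2]

lemma Ach_tok {W : α → α → T → ℝ} (hW : ∀ x y τ, 0 ≤ W x y τ) (hW1 : ∀ x y, ∑ τ, W x y τ = 1)
    {k : ℕ} {h : T → (α → ℝ) → ℝ} (H : ∀ τ, Ach k (h τ)) :
    Ach (k + 2) (fun p => ∑ τ, tok W p τ * h τ p) := by
  have h1 := Ach_succ (fun x => Ach_succ (fun y => Ach_comb Finset.univ (W x y) (fun i _ => hW x y i)
    (hW1 x y).le (fun i _ => H i)))
  refine Ach_congr h1 fun p _ => ?_
  unfold tok
  simp only [Finset.sum_mul, Finset.mul_sum]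
  rw [Finset.sum_comm]
  rw [Finset.sum_comm (s := Finset.univ (α := T))]
  rw [Finset.sum_comm]
  refine Finset.sum_congr rfl fun x _ => ?_
  rw [Finset.sum_comm]
  refine Finset.sum_congr rfl fun y _ => Finset.sum_congr rfl fun τ _ => ?_
  ring

lemma Ach_toks {W : α → α → T → ℝ} (hW : ∀ x y τ, 0 ≤ W x y τ) (hW1 : ∀ x y, ∑ τ, W x y τ = 1)
    {k : ℕ} (M : ℕ) {h : (Fin M → T) → (α → ℝ) → ℝ} (H : ∀ τ, Ach k (h τ)) :
    Ach (k + 2 * M) (fun p => ∑ x, (∏ i, tok W p (x i)) * h x p) := by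
  induction M with
  | zero =>
    refine Ach_congr (H default) fun p _ => ?_
    simp
  | succ M ih =>
    have h1 : ∀ τ, Ach (k + 2 * M) (fun p => ∑ x : Fin M → T, (∏ i, tok W p (x i)) * h (Fin.cons τ x) p) :=
      fun τ => ih (fun x => H (Fin.cons τ x))
    refine Ach_congr (Ach_tok hW hW1 h1) fun p _ => ?_
    rw [← (Fin.consEquiv (fun _ : Fin (M+1) => T)).sum_comp, Fintype.sum_prod_type]
    refine Finset.sum_congr rfl fun x _ => ?_
    rw [Finset.mul_sum]
    refine Finset.sum_congr rfl fun z _ => ?_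
    simp [Fin.consEquiv, Fin.prod_univ_succ, mul_assoc]

lemma Ach_TP [DecidableEq T] {W : α → α → T → ℝ} (hW : ∀ x y τ, 0 ≤ W x y τ) (hW1 : ∀ x y, ∑ τ, W x y τ = 1)
    {k : ℕ} (K : ℕ) {μ : ℝ} (hμ : 0 ≤ μ) {h : (T → ℕ) → (α → ℝ) → ℝ} (H : ∀ N, Ach k (h N)) :
    Ach (k + 2 * K) (fun p => TP K μ (tok W p) (fun N => h N p)) := by
  refine Ach_comb (Finset.range (K+1)) (fun M => po μ M) (fun M _ => po_nonneg hμ M) (po_sum_le K hμ) ?_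
  intro M hM
  have := Finset.mem_range.mp hM
  exact Ach_mono (by omega) (Ach_toks hW hW1 M (fun x => H (cnt x)))
end ach


section stage3
variable {β : Type*} [Fintype β] [DecidableEq β]

noncomputable def ZZ (N : β × Fin 4 → ℕ) : ℝ := ∑ t, phi (quad fun i => N (t, i))

lemma test_gen (K : ℕ) {μ : ℝ} (hμ : 0 ≤ μ)
    {w : β × Fin 4 → ℝ} (hw0 : ∀ τ, 0 ≤ w τ) (hw : ∑ τ, w τ = 1)
    (a b : β → ℝ≥0) (ha0 : ∀ t, μ * w (t, 0) = a t) (ha1 : ∀ t, μ * w (t, 1) = a t)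
    (hb2 : ∀ t, μ * w (t, 2) = b t) (hb3 : ∀ t, μ * w (t, 3) = b t) (l θ : ℝ) (E : β → ℝ)
    (hE : ∀ t, ∫ z, Real.exp (l * phi z) ∂(QQ (a t) (b t)) ≤ Real.exp (E t))
    (f : (β × Fin 4 → ℕ) → ℝ) (hf : ∀ N, f N ≤ Real.exp (l * ZZ N - l * θ)) :
    TP K μ w f ≤ Real.exp (- l * θ + ∑ t, E t) := by
  have h1 : TP K μ w f ≤ TP K μ w (fun N => Real.exp (-l * θ) * ∏ t, Real.exp (l * phi (quad fun i => N (t, i)))) := by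
    refine TP_mono K hμ hw0 fun N _ => (hf N).trans (le_of_eq ?_)
    rw [← Real.exp_sum, ← Real.exp_add, ← Finset.mul_sum]
    congr 1
    unfold ZZ; ring
  refine h1.trans ?_
  rw [TP_smul, Real.exp_add, Real.exp_sum]
  refine mul_le_mul_of_nonneg_left ?_ (Real.exp_pos _).le
  exact TP_le_prod4 K hμ hw0 hw a b ha0 ha1 hb2 hb3 (fun z => Real.exp (l * phi z))
    (fun z => (Real.exp_pos _).le) _ fun t => ⟨phi_exp_integrable _ _ _, hE t⟩
end stage3

lemma sq_exp_le (t : ℝ) (ht : 0 ≤ t) : t^2 * Real.exp (-t/16) ≤ 256 := by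
  have h1 := Real.add_one_le_exp (t/32 - 1)
  have h3 := Real.exp_one_gt_d9
  have h2 : Real.exp (t/32) = Real.exp (t/32 - 1) * Real.exp 1 := by rw [← Real.exp_add]; ring_nf
  have h4 : t/16 ≤ Real.exp (t/32) := by
    rw [h2]; nlinarith [Real.exp_pos 1]
  have h5 : Real.exp (-t/16) * Real.exp (t/32)^2 = 1 := by
    rw [← Real.exp_nat_mul, ← Real.exp_add]
    have : -t/16 + (2:ℕ) * (t/32) = 0 := by push_cast; ring
    rw [this, Real.exp_zero]
  have h6 : (t/16)^2 ≤ Real.exp (t/32)^2 := by gcongr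
  have := Real.exp_pos (-t/16)
  nlinarith

lemma t_exp_neg_le (t : ℝ) (ht : 0 ≤ t) : t * Real.exp (-t/16) ≤ 16 := by
  have h1 := Real.add_one_le_exp (t/16)
  have h5 : Real.exp (-t/16) * Real.exp (t/16) = 1 := by
    rw [← Real.exp_add]
    have : -t/16 + t/16 = 0 := by ring
    rw [this, Real.exp_zero]
  have := Real.exp_pos (-t/16)
  nlinarith

section flat
variable {T : Type*} [Fintype T] [DecidableEq T]

lemma bad_mgf (u : ℝ≥0) (x : ℝ) (h0 : 0 ≤ x) (h1 : x ≤ u/16) :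
    Integrable (fun n : ℕ => Real.exp (if (n:ℝ) < u/2 then x else 0)) (poissonMeasure u) ∧
    ∫ n : ℕ, Real.exp (if (n:ℝ) < u/2 then x else 0) ∂(poissonMeasure u) ≤
      Real.exp (x * Real.exp (-u/16)) := by
  have hi : Integrable (fun n : ℕ => Real.exp (if (n:ℝ) < u/2 then x else 0)) (poissonMeasure u) := by
    refine po_bdd_integrable (Real.exp x) fun n => ?_
    rw [abs_of_pos (Real.exp_pos _), Real.exp_le_exp]
    split_ifs <;> linarith
  refine ⟨hi, ?_⟩
  have e : (fun n : ℕ => Real.exp (if (n:ℝ) < u/2 then x else 0)) =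
      fun n : ℕ => 1 + (Real.exp x - 1) * ({n : ℕ | (n:ℝ) < u/2}.indicator 1 n) := by
    funext n
    by_cases h : (n:ℝ) < u/2 <;> simp [h]
  have hind : Integrable (fun n : ℕ => ({n : ℕ | (n:ℝ) < u/2}.indicator (1 : ℕ → ℝ) n)) (poissonMeasure u) :=
    (integrable_const (1:ℝ)).indicator MeasurableSet.of_discrete
  rw [e, integral_add (integrable_const _) (hind.const_mul _),
    integral_const_mul, integral_indicator_one MeasurableSet.of_discrete]
  have hq := po_lower u
  have hx : Real.exp x - 1 ≤ x * Real.exp (u/16) := by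
    have h2 : Real.exp x ≤ Real.exp (u/16) := Real.exp_le_exp.mpr h1
    have h3 := Real.add_one_le_exp (-x)
    have h4 : Real.exp (-x) * Real.exp x = 1 := by rw [← Real.exp_add]; simp
    have : Real.exp x - 1 ≤ x * Real.exp x := by nlinarith [Real.exp_pos x]
    nlinarith
  have hx0 : 0 ≤ Real.exp x - 1 := by have := Real.one_le_exp h0; linarith
  have h6 : Real.exp (u/16) * Real.exp (-u/8) = Real.exp (-u/16) := by
    rw [← Real.exp_add]; congr 1; ring
  have h7 : (Real.exp x - 1) * (poissonMeasure u).real {n : ℕ | (n:ℝ) < u/2} ≤ x * Real.exp (-u/16) := by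
    calc _ ≤ (x * Real.exp (u/16)) * Real.exp (-u/8) := by gcongr
      _ = _ := by rw [mul_assoc, h6]
  have h8 := Real.add_one_le_exp (x * Real.exp (-u/16))
  simp only [integral_const, probReal_univ, smul_eq_mul, mul_one]
  linarith

lemma bad_sum (K : ℕ) {μ : ℝ} (hμ : 0 ≤ μ) {w : T → ℝ} (hw0 : ∀ τ, 0 ≤ w τ) (hw : ∑ τ, w τ = 1)
    (X : T → ℝ) (hX0 : ∀ τ, 0 ≤ X τ) (hX : ∀ τ, X τ ≤ μ * w τ) (S L : ℝ)
    (hS : ∑ τ, X τ * Real.exp (-(μ * w τ)/16) ≤ 16 * S) (f : (T → ℕ) → ℝ)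
    (hf : ∀ N, f N ≤ if 16 * (S + L) < ∑ τ, (if (N τ : ℝ) < μ * w τ / 2 then X τ else 0) then 1 else 0) :
    TP K μ w f ≤ Real.exp (-L) := by
  have h1 : TP K μ w f ≤ TP K μ w (fun N => Real.exp (-(S+L)) *
      ∏ τ, Real.exp (if (N τ : ℝ) < μ * w τ / 2 then X τ / 16 else 0)) := by
    refine TP_mono K hμ hw0 fun N _ => (hf N).trans ?_
    split_ifs with h
    · rw [← Real.exp_sum, ← Real.exp_add]
      apply Real.one_le_exp
      have e : ∑ τ, (if (N τ : ℝ) < μ * w τ / 2 then X τ / 16 else 0) =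
          (∑ τ, (if (N τ : ℝ) < μ * w τ / 2 then X τ else 0)) / 16 := by
        rw [Finset.sum_div]
        refine Finset.sum_congr rfl fun τ _ => ?_
        split_ifs <;> simp
      rw [e]; linarith
    · positivity
  refine h1.trans ?_
  rw [TP_smul]
  have h2 := TP_le_prod K hμ hw0 hw (fun τ n => Real.exp (if (n : ℝ) < μ * w τ / 2 then X τ / 16 else 0))
    (fun τ n => (Real.exp_pos _).le) (fun τ => Real.exp (X τ / 16 * Real.exp (-(μ * w τ)/16))) (fun τ => by
      have hc : ((μ * w τ).toNNReal : ℝ) = μ * w τ := Real.coe_toNNReal _ (mul_nonneg hμ (hw0 τ))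
      have := bad_mgf (μ * w τ).toNNReal (X τ / 16) (by have := hX0 τ; positivity) (by
        rw [hc]; have := hX τ; linarith)
      rw [hc] at this
      exact this)
  rw [← Real.exp_sum] at h2
  calc _ ≤ Real.exp (-(S+L)) * Real.exp S := by
        gcongr
        refine h2.trans (Real.exp_le_exp.mpr ?_)
        have : ∑ τ, X τ / 16 * Real.exp (-(μ * w τ)/16) = (∑ τ, X τ * Real.exp (-(μ * w τ)/16)) / 16 := by
          rw [Finset.sum_div]
          refine Finset.sum_congr rfl fun τ _ => by ring
        rw [this]; linarith
    _ = _ := by rw [← Real.exp_add]; congr 1; ring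

/-- number of cells in the split -/
noncomputable def spl (F μ : ℝ) (N : ℕ) : ℕ := 1 + ⌊F * N / μ⌋₊

lemma spl_pos (F μ : ℝ) (N : ℕ) : (1:ℝ) ≤ spl F μ N := by unfold spl; push_cast; linarith [(Nat.cast_nonneg ⌊F * N / μ⌋₊ : (0:ℝ) ≤ _)]

lemma spl_ge (F μ : ℝ) (N : ℕ) : F * N / μ ≤ spl F μ N := by
  unfold spl; push_cast; linarith [Nat.lt_floor_add_one (F * N / μ)]

lemma spl_sum (F μ : ℝ) (hF : 0 ≤ F) (hμ : 0 < μ) (N : T → ℕ) (K : ℕ) (hK : (K:ℝ) = 4 * μ) (hN : ∑ τ, N τ ≤ K) :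
    ∑ τ, (spl F μ (N τ) : ℝ) ≤ Fintype.card T + 4 * F := by
  have h : ∀ τ, (spl F μ (N τ) : ℝ) ≤ 1 + (F/μ) * N τ := fun τ => by
    unfold spl; push_cast
    have := Nat.floor_le (show 0 ≤ F * N τ / μ by positivity)
    have e : F * N τ / μ = (F/μ) * N τ := by ring
    linarith
  refine (Finset.sum_le_sum fun τ _ => h τ).trans ?_
  rw [Finset.sum_add_distrib, ← Finset.mul_sum]
  have h1 : (∑ τ, (N τ : ℝ)) ≤ 4 * μ := by rw [← hK]; exact_mod_cast hN
  have h2 : (F/μ) * (∑ τ, (N τ : ℝ)) ≤ (F/μ) * (4*μ) := by gcongr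
  have h3 : (F/μ) * (4*μ) = 4 * F := by field_simp
  simp
  linarith

/-- column functional -/
noncomputable def Bc (F μ : ℝ) (w : T → ℝ) (κ : T → ℝ) : ℝ :=
  ∑ j, (μ * w j) * min 1 ((2/F) * (μ * w j) * κ j)

lemma flat_col (K : ℕ) {μ F m : ℝ} (hμ : 0 < μ) (hm : m = Fintype.card T) (hm1 : 1 ≤ m) (hmF : m ≤ F)
    {w : T → ℝ} (hw0 : ∀ τ, 0 ≤ w τ) (hw : ∑ τ, w τ = 1) (L : ℝ) :
    TP K μ w (fun N => if 4 * μ^2/(F*m) + 512 + 16 * L < Bc F μ w (fun j => 1 / (spl m μ (N j))) then 1 else 0)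
      ≤ Real.exp (-L) := by
  have hF : 0 < F := by linarith
  refine bad_sum K hμ.le hw0 hw (fun j => (μ * w j) * min 1 ((2/F) * (μ * w j)))
    (fun j => mul_nonneg (mul_nonneg hμ.le (hw0 j)) (le_min zero_le_one (by have := hw0 j; positivity)))
    (fun j => mul_le_of_le_one_right (mul_nonneg hμ.le (hw0 j)) (min_le_left _ _)) 32 L ?_ _ ?_
  · have h : ∀ j, (μ * w j) * min 1 ((2/F) * (μ * w j)) * Real.exp (-(μ * w j)/16) ≤ 512 / F := fun j => by
      have hu : 0 ≤ μ * w j := mul_nonneg hμ.le (hw0 j)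
      have := sq_exp_le (μ * w j) hu
      calc _ ≤ (μ * w j) * ((2/F) * (μ * w j)) * Real.exp (-(μ * w j)/16) := by
            gcongr; exact min_le_right _ _
        _ = (2/F) * ((μ * w j)^2 * Real.exp (-(μ * w j)/16)) := by ring
        _ ≤ (2/F) * 256 := by gcongr
        _ = _ := by ring
    refine (Finset.sum_le_sum fun j _ => h j).trans ?_
    rw [Finset.sum_const, Finset.card_univ, nsmul_eq_mul, ← hm, mul_div_assoc', div_le_iff₀ hF]
    linarith
  · intro N
    have key : Bc F μ w (fun j => 1 / (spl m μ (N j))) ≤ 4 * μ^2/(F*m) +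
        ∑ τ, (if (N τ : ℝ) < μ * w τ / 2 then (μ * w τ) * min 1 ((2/F) * (μ * w τ)) else 0) := by
      have h : ∀ j, (μ * w j) * min 1 ((2/F) * (μ * w j) * (1 / (spl m μ (N j)))) ≤
          (4 * μ^2/(F*m)) * w j + (if (N j : ℝ) < μ * w j / 2 then (μ * w j) * min 1 ((2/F) * (μ * w j)) else 0) := by
        intro j
        have hu : 0 ≤ μ * w j := mul_nonneg hμ.le (hw0 j)
        have hw := hw0 j
        have hs1 := spl_pos m μ (N j)
        have hs0 : (0:ℝ) < spl m μ (N j) := by linarith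
        split_ifs with hc
        · have : (μ * w j) * min 1 ((2/F) * (μ * w j) * (1 / (spl m μ (N j)))) ≤
              (μ * w j) * min 1 ((2/F) * (μ * w j)) := by
            exact mul_le_mul_of_nonneg_left (min_le_min le_rfl (mul_le_of_le_one_right
              (by positivity) ((div_le_one hs0).mpr hs1))) hu
          have : 0 ≤ (4 * μ^2/(F*m)) * w j := by positivity
          linarith
        · push Not at hc
          have hs := spl_ge m μ (N j)
          have hs2 : m * (w j / 2) ≤ spl m μ (N j) := by
            refine le_trans ?_ hs
            rw [le_div_iff₀ hμ]
            nlinarith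
          have : (2/F) * (μ * w j) * (1 / (spl m μ (N j))) ≤ 4 * μ/(F*m) := by
            rw [mul_one_div, div_le_iff₀ hs0]
            calc (2/F) * (μ * w j) = 4 * μ/(F*m) * (m * (w j / 2)) := by field_simp; ring
              _ ≤ _ := by gcongr
          calc _ ≤ (μ * w j) * (4 * μ/(F*m)) := by
                gcongr; exact (min_le_right _ _).trans this
            _ = _ := by ring
      unfold Bc
      refine (Finset.sum_le_sum fun j _ => h j).trans ?_
      rw [Finset.sum_add_distrib, ← Finset.mul_sum, hw, mul_one]
    split_ifs with h1 h2 h2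
    · exact le_rfl
    · exfalso; linarith
    · exact zero_le_one
    · exact le_rfl

/-- total variance proxy -/
noncomputable def Vt {I J : Type*} [Fintype I] [Fintype J] (μ : ℝ) (r : I → ℝ) (s : J → ℝ) (ρ : I → ℝ) (κ : J → ℝ) : ℝ :=
  ∑ i, ∑ j, min (μ * (r i * s j)) ((μ * (r i * s j))^2 * (ρ i * κ j))

lemma Vt_le_mu {I J : Type*} [Fintype I] [Fintype J] (μ : ℝ) {r : I → ℝ} {s : J → ℝ}
    (hr : ∑ i, r i = 1) (hs : ∑ j, s j = 1) (ρ : I → ℝ) (κ : J → ℝ) : Vt μ r s ρ κ ≤ μ := by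
  unfold Vt
  calc _ ≤ ∑ i, ∑ j, μ * (r i * s j) := Finset.sum_le_sum fun i _ => Finset.sum_le_sum fun j _ => min_le_left _ _
    _ = μ := by simp only [← Finset.mul_sum, hs, hr, mul_one]

lemma flat_row {I J : Type*} [Fintype I] [Fintype J] [DecidableEq I] (K : ℕ) {μ F : ℝ} (hμ : 0 < μ)
    (hF : 0 < F) (hFm : F = min μ (Fintype.card I))
    {r : I → ℝ} {s : J → ℝ} (hr0 : ∀ i, 0 ≤ r i) (hs0 : ∀ j, 0 ≤ s j)
    (hr : ∑ i, r i = 1) (hs : ∑ j, s j = 1) (κ : J → ℝ) (hκ0 : ∀ j, 0 ≤ κ j) (hκ1 : ∀ j, κ j ≤ 1) (L : ℝ) :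
    TP K μ r (fun N => if 257 * Bc F μ s κ + 16 * L < Vt μ r s (fun i => 1 / (spl F μ (N i))) κ then 1 else 0)
      ≤ Real.exp (-L) := by
  have hFμ : F ≤ μ := by rw [hFm]; exact min_le_left _ _
  have hs1 : ∀ j, s j ≤ 1 := fun j => by
    rw [← hs]; exact Finset.single_le_sum (fun i _ => hs0 i) (Finset.mem_univ j)
  have hX0 : ∀ i j, 0 ≤ min (μ * (r i * s j)) ((μ * (r i * s j))^2 * κ j) := fun i j =>
    le_min (mul_nonneg hμ.le (mul_nonneg (hr0 i) (hs0 j))) (mul_nonneg (sq_nonneg _) (hκ0 j))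
  set Γ := ∑ j, s j^2 * κ j with hΓ
  have hΓ0 : 0 ≤ Γ := Finset.sum_nonneg fun j _ => mul_nonneg (sq_nonneg _) (hκ0 j)
  have hΓB : F * Γ ≤ Bc F μ s κ := by
    unfold Bc
    rw [hΓ, Finset.mul_sum]
    refine Finset.sum_le_sum fun j _ => ?_
    have h1 := hs0 j
    have h2 := hs1 j
    have h3 := hκ0 j
    have h4 := hκ1 j
    have e : F * (s j ^2 * κ j) = (μ * s j) * ((F * s j * κ j) / μ) := by field_simp
    rw [e]
    refine mul_le_mul_of_nonneg_left (le_min ?_ ?_) (by positivity)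
    · rw [div_le_one hμ]
      calc F * s j * κ j ≤ μ * 1 * 1 := by gcongr
        _ = μ := by ring
    · rw [div_le_iff₀ hμ]
      have : F * F ≤ 2 * (μ * μ) := by nlinarith
      have e2 : (2/F) * (μ * s j) * κ j * μ = (s j * κ j) * (2 * (μ * μ) / F) := by ring
      rw [e2]
      have e3 : F ≤ 2 * (μ * μ) / F := by rw [le_div_iff₀ hF]; exact this
      calc F * s j * κ j = (s j * κ j) * F := by ring
        _ ≤ _ := by gcongr
  refine bad_sum K hμ.le hr0 hr (fun i => ∑ j, min (μ * (r i * s j)) ((μ * (r i * s j))^2 * κ j))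
    (fun i => Finset.sum_nonneg fun j _ => hX0 i j) (fun i => ?_) (16 * Bc F μ s κ) L ?_ _ ?_
  · calc _ ≤ ∑ j, μ * (r i * s j) := Finset.sum_le_sum fun j _ => min_le_left _ _
      _ = μ * r i := by simp only [← Finset.mul_sum, hs, mul_one]
  · have h : ∀ i, (∑ j, min (μ * (r i * s j)) ((μ * (r i * s j))^2 * κ j)) * Real.exp (-(μ * r i)/16) ≤
        Γ * ((μ * r i)^2 * Real.exp (-(μ * r i)/16)) := fun i => by
      have : (∑ j, min (μ * (r i * s j)) ((μ * (r i * s j))^2 * κ j)) ≤ Γ * (μ * r i)^2 := by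
        rw [hΓ, Finset.sum_mul]
        refine Finset.sum_le_sum fun j _ => (min_le_right _ _).trans (le_of_eq (by ring))
      calc _ ≤ (Γ * (μ * r i)^2) * Real.exp (-(μ * r i)/16) := by gcongr
        _ = _ := by ring
    refine (Finset.sum_le_sum fun i _ => h i).trans ?_
    rw [← Finset.mul_sum]
    have hsum : ∑ i, (μ * r i)^2 * Real.exp (-(μ * r i)/16) ≤ 256 * F := by
      rw [hFm]
      rcases min_cases μ (Fintype.card I : ℝ) with ⟨e, _⟩ | ⟨e, _⟩ <;> rw [e]
      · calc _ ≤ ∑ i, (μ * r i) * 16 := Finset.sum_le_sum fun i _ => by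
              have hu := mul_nonneg hμ.le (hr0 i)
              have := t_exp_neg_le (μ * r i) hu
              calc (μ * r i)^2 * Real.exp (-(μ * r i)/16) = (μ * r i) * ((μ * r i) * Real.exp (-(μ * r i)/16)) := by ring
                _ ≤ _ := by gcongr
          _ = 16 * μ := by rw [← Finset.sum_mul, ← Finset.mul_sum, hr]; ring
          _ ≤ _ := by linarith
      · calc _ ≤ ∑ i : I, (256:ℝ) := Finset.sum_le_sum fun i _ =>
              sq_exp_le (μ * r i) (mul_nonneg hμ.le (hr0 i))
          _ = _ := by simp [mul_comm]
    nlinarith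
  · intro N
    have key : Vt μ r s (fun i => 1 / (spl F μ (N i))) κ ≤ Bc F μ s κ +
        ∑ i, (if (N i : ℝ) < μ * r i / 2 then ∑ j, min (μ * (r i * s j)) ((μ * (r i * s j))^2 * κ j) else 0) := by
      have h : ∀ i, ∑ j, min (μ * (r i * s j)) ((μ * (r i * s j))^2 * ((1 / (spl F μ (N i))) * κ j)) ≤
          r i * Bc F μ s κ +
          (if (N i : ℝ) < μ * r i / 2 then ∑ j, min (μ * (r i * s j)) ((μ * (r i * s j))^2 * κ j) else 0) := by
        intro i
        have hw := hr0 i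
        have hs1 := spl_pos F μ (N i)
        have hsp : (0:ℝ) < spl F μ (N i) := by linarith
        have hB0 : 0 ≤ Bc F μ s κ := le_trans (by positivity) hΓB
        split_ifs with hc
        · have : ∑ j, min (μ * (r i * s j)) ((μ * (r i * s j))^2 * ((1 / (spl F μ (N i))) * κ j)) ≤
              ∑ j, min (μ * (r i * s j)) ((μ * (r i * s j))^2 * κ j) := by
            refine Finset.sum_le_sum fun j _ => min_le_min le_rfl ?_
            refine mul_le_mul_of_nonneg_left ?_ (sq_nonneg _)
            exact mul_le_of_le_one_left (hκ0 j) ((div_le_one hsp).mpr hs1)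
          have : 0 ≤ r i * Bc F μ s κ := by positivity
          linarith
        · push Not at hc
          rw [add_zero]
          unfold Bc
          rw [Finset.mul_sum]
          refine Finset.sum_le_sum fun j _ => ?_
          have h1 := hs0 j
          have h3 := hκ0 j
          have hs := spl_ge F μ (N i)
          have hs2 : F * (r i / 2) ≤ spl F μ (N i) := by
            refine le_trans ?_ hs
            rw [le_div_iff₀ hμ]
            nlinarith
          have e0 : r i * ((μ * s j) * min 1 ((2/F)*(μ*s j)*κ j)) =
              min (μ*(r i*s j)) (r i*(μ*s j)*((2/F)*(μ*s j)*κ j)) := by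
            rw [← mul_assoc (r i), mul_min_of_nonneg _ _ (by positivity)]
            congr 1; ring
          rw [e0]
          refine min_le_min le_rfl ?_
          have e : (μ * (r i * s j))^2 * ((1 / (spl F μ (N i))) * κ j) =
              (μ^2 * r i * s j^2 * κ j) * (r i * (1 / (spl F μ (N i)))) := by ring
          have e2 : r i * (μ * s j) * ((2/F) * (μ * s j) * κ j) = (μ^2 * r i * s j^2 * κ j) * (2/F) := by ring
          rw [e, e2]
          refine mul_le_mul_of_nonneg_left ?_ (by positivity)
          rw [mul_one_div, div_le_div_iff₀ hsp hF]
          linarith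
      unfold Vt
      refine (Finset.sum_le_sum fun j _ => h j).trans ?_
      rw [Finset.sum_add_distrib, ← Finset.sum_mul, hr, one_mul]
    split_ifs with h1 h2 h2
    · exact le_rfl
    · exfalso; linarith
    · exact zero_le_one
    · exact le_rfl
end flat


section tokens
variable {n m : ℕ}

/-- row marginal -/
noncomputable def mr (p : Fin n × Fin m → ℝ) (i : Fin n) : ℝ := ∑ j, p (i, j)
/-- column marginal -/
noncomputable def mc (p : Fin n × Fin m → ℝ) (j : Fin m) : ℝ := ∑ i, p (i, j)

lemma mr_pmf {p : Fin n × Fin m → ℝ} (hp : IsPMF p) : IsPMF (mr p) :=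
  ⟨fun i => Finset.sum_nonneg fun j _ => hp.1 _, by
    rw [← hp.2, Fintype.sum_prod_type]; rfl⟩

lemma mc_pmf {p : Fin n × Fin m → ℝ} (hp : IsPMF p) : IsPMF (mc p) :=
  ⟨fun i => Finset.sum_nonneg fun j _ => hp.1 _, by
    rw [← hp.2, Fintype.sum_prod_type_right]; rfl⟩

lemma prod_marg {p : Fin n × Fin m → ℝ} (hp : IsProduct p) (i : Fin n) (j : Fin m) :
    p (i, j) = mr p i * mc p j := by
  obtain ⟨r, s, hr, hs, h⟩ := hp
  have h1 : mr p i = r i := by simp [mr, h, ← Finset.mul_sum, hs.2]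
  have h2 : mc p j = s j := by simp [mc, h, ← Finset.sum_mul, hr.2]
  rw [h1, h2, h]

def W1 (x _y : Fin n × Fin m) (j : Fin m) : ℝ := if x.2 = j then 1 else 0
def W2 (x _y : Fin n × Fin m) (i : Fin n) : ℝ := if x.1 = i then 1 else 0

lemma W1_nonneg (x y : Fin n × Fin m) (j : Fin m) : 0 ≤ W1 x y j := by
  unfold W1; split_ifs <;> norm_num
lemma W2_nonneg (x y : Fin n × Fin m) (j : Fin n) : 0 ≤ W2 x y j := by
  unfold W2; split_ifs <;> norm_num
lemma W1_sum (x y : Fin n × Fin m) : ∑ j, W1 x y j = 1 := by simp [W1]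
lemma W2_sum (x y : Fin n × Fin m) : ∑ j, W2 x y j = 1 := by simp [W2]

lemma tok_W1 {p : Fin n × Fin m → ℝ} (hp : IsPMF p) : tok W1 p = mc p := by
  funext j
  unfold tok W1 mc
  simp only [← Finset.sum_mul, hp.2, one_mul]
  simp only [Fintype.sum_prod_type, mul_ite, mul_one, mul_zero]
  simp

lemma tok_W2 {p : Fin n × Fin m → ℝ} (hp : IsPMF p) : tok W2 p = mr p := by
  funext j
  unfold tok W2 mr
  simp only [← Finset.sum_mul, hp.2, one_mul]
  simp only [Fintype.sum_prod_type, mul_ite, mul_one, mul_zero]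
  rw [Finset.sum_eq_single j]
  · simp
  · intro b _ hb; simp [hb]
  · simp

abbrev Bins (R : Fin n → ℕ) (C : Fin m → ℕ) := (Σ i, Fin (R i)) × (Σ j, Fin (C j))

lemma bins_sum (R : Fin n → ℕ) (C : Fin m → ℕ) (f : Fin n → Fin m → ℝ) :
    ∑ t : Bins R C, f t.1.1 t.2.1 = ∑ i, ∑ j, (R i : ℝ) * C j * f i j := by
  rw [Fintype.sum_prod_type, Fintype.sum_sigma]
  simp only [Fintype.sum_sigma, Finset.sum_const, Finset.card_univ, Fintype.card_fin, nsmul_eq_mul, Finset.mul_sum]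
  simp only [mul_assoc]

noncomputable def W3 (R : Fin n → ℕ) (C : Fin m → ℕ) (x y : Fin n × Fin m) (τ : Bins R C × Fin 4) : ℝ :=
  (1/4) * (1/(R τ.1.1.1) * (1 / (C τ.1.2.1))) *
    ((if x.1 = τ.1.1.1 then 1 else 0) *
      (if τ.2 = 0 ∨ τ.2 = 1 then (if x.2 = τ.1.2.1 then 1 else 0) else (if y.2 = τ.1.2.1 then 1 else 0)))

lemma W3_nonneg (R : Fin n → ℕ) (C : Fin m → ℕ) (x y : Fin n × Fin m) (τ : Bins R C × Fin 4) : 0 ≤ W3 R C x y τ := by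
  unfold W3; split_ifs <;> positivity

lemma W3_sum (R : Fin n → ℕ) (C : Fin m → ℕ) (hR : ∀ i, (1:ℝ) ≤ R i) (hC : ∀ j, (1:ℝ) ≤ C j) (x y : Fin n × Fin m) :
    ∑ τ, W3 R C x y τ = 1 := by
  rw [Fintype.sum_prod_type_right]
  have h : ∀ ρ : Fin 4, ∑ t : Bins R C, W3 R C x y (t, ρ) = 1/4 := by
    intro ρ
    unfold W3
    rw [bins_sum R C (fun i j => (1/4) * (1/(R i) * (1 / (C j))) *
    ((if x.1 = i then 1 else 0) *
      (if ρ = 0 ∨ ρ = 1 then (if x.2 = j then 1 else 0) else (if y.2 = j then 1 else 0))))]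
    have : ∀ i j, (R i:ℝ) * C j * ((1/4) * (1/(R i) * (1 / (C j))) *
    ((if x.1 = i then 1 else 0) *
      (if ρ = 0 ∨ ρ = 1 then (if x.2 = j then 1 else 0) else (if y.2 = j then 1 else 0)))) =
      (1/4) * ((if x.1 = i then 1 else 0) *
      (if ρ = 0 ∨ ρ = 1 then (if x.2 = j then 1 else 0) else (if y.2 = j then 1 else 0))) := by
      intro i j
      have h1 : (R i:ℝ) ≠ 0 := by linarith [hR i]
      have h2 : (C j:ℝ) ≠ 0 := by linarith [hC j]
      field_simp
    simp only [this, ← Finset.mul_sum]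
    by_cases hρ : ρ = 0 ∨ ρ = 1 <;> simp [hρ]
  simp [h]

lemma tok_W3a (R : Fin n → ℕ) (C : Fin m → ℕ) {p : Fin n × Fin m → ℝ} (hp : IsPMF p) (t : Bins R C) (ρ : Fin 4)
    (hρ : ρ = 0 ∨ ρ = 1) :
    tok (W3 R C) p (t, ρ) = (1/4) * (1/(R t.1.1) * (1 / (C t.2.1))) * p (t.1.1, t.2.1) := by
  unfold tok W3
  simp only [hρ, if_true, ← Finset.sum_mul, hp.2, one_mul]
  rw [Finset.sum_eq_single (t.1.1, t.2.1)]
  · simp; ring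
  · intro b _ hb
    have : ¬ (b.1 = t.1.1 ∧ b.2 = t.2.1) := fun h => hb (Prod.ext h.1 h.2)
    by_cases h1 : b.1 = t.1.1
    · have h2 : b.2 ≠ t.2.1 := fun h => this ⟨h1, h⟩
      simp [h2]
    · simp [h1]
  · simp

lemma tok_W3b (R : Fin n → ℕ) (C : Fin m → ℕ) {p : Fin n × Fin m → ℝ} (hp : IsPMF p) (t : Bins R C) (ρ : Fin 4)
    (hρ : ¬ (ρ = 0 ∨ ρ = 1)) :
    tok (W3 R C) p (t, ρ) = (1/4) * (1/(R t.1.1) * (1 / (C t.2.1))) * (mr p t.1.1 * mc p t.2.1) := by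
  rw [← tok_W1 hp, ← tok_W2 hp]
  unfold tok W3 W1 W2
  simp only [hρ, if_false, ← Finset.sum_mul, hp.2, one_mul]
  simp only [Finset.mul_sum, Finset.sum_mul]
  rw [Finset.sum_comm]
  refine Finset.sum_congr rfl fun x _ => Finset.sum_congr rfl fun y _ => ?_
  ring
end tokens


section st3
variable {n m : ℕ}

/-- Poisson parameter of bins of p -/
noncomputable def aN (μ : ℝ) (R : Fin n → ℕ) (C : Fin m → ℕ) (p : Fin n × Fin m → ℝ) (t : Bins R C) : ℝ≥0 :=
  (μ * (1/(R t.1.1) * (1 / (C t.2.1)) * p (t.1.1, t.2.1))).toNNReal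
noncomputable def bN (μ : ℝ) (R : Fin n → ℕ) (C : Fin m → ℕ) (p : Fin n × Fin m → ℝ) (t : Bins R C) : ℝ≥0 :=
  (μ * (1/(R t.1.1) * (1 / (C t.2.1)) * (mr p t.1.1 * mc p t.2.1))).toNNReal

variable (R : Fin n → ℕ) (C : Fin m → ℕ) {p : Fin n × Fin m → ℝ}

lemma aN_eq {μ : ℝ} (hμ : 0 ≤ μ) (hp : IsPMF p) (t : Bins R C) :
    (aN μ R C p t : ℝ) = μ * (1/(R t.1.1) * (1 / (C t.2.1)) * p (t.1.1, t.2.1)) :=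
  Real.coe_toNNReal _ (mul_nonneg hμ (mul_nonneg (by positivity) (hp.1 _)))

lemma bN_eq {μ : ℝ} (hμ : 0 ≤ μ) (hp : IsPMF p) (t : Bins R C) :
    (bN μ R C p t : ℝ) = μ * (1/(R t.1.1) * (1 / (C t.2.1)) * (mr p t.1.1 * mc p t.2.1)) :=
  Real.coe_toNNReal _ (mul_nonneg hμ (mul_nonneg (by positivity) (mul_nonneg ((mr_pmf hp).1 _) ((mc_pmf hp).1 _))))

lemma bN_min (hR : ∀ i, (1:ℝ) ≤ R i) (hC : ∀ j, (1:ℝ) ≤ C j) {μ : ℝ} (hμ : 0 ≤ μ) (hp : IsPMF p) :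
    ∑ t, min (bN μ R C p t : ℝ) ((bN μ R C p t : ℝ)^2) =
      Vt μ (mr p) (mc p) (fun i => 1 / (R i)) (fun j => 1 / (C j)) := by
  simp only [bN_eq R C hμ hp]
  rw [bins_sum R C (fun i j => min (μ * (1/(R i) * (1 / (C j)) * (mr p i * mc p j)))
    ((μ * (1/(R i) * (1 / (C j)) * (mr p i * mc p j)))^2))]
  unfold Vt
  refine Finset.sum_congr rfl fun i _ => Finset.sum_congr rfl fun j _ => ?_
  have h1 : (R i:ℝ) ≠ 0 := by linarith [hR i]
  have h2 : (C j:ℝ) ≠ 0 := by linarith [hC j]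
  rw [mul_min_of_nonneg _ _ (by positivity)]
  congr 1 <;> field_simp

lemma acc3_sound (hR : ∀ i, (1:ℝ) ≤ R i) (hC : ∀ j, (1:ℝ) ≤ C j) (K : ℕ) {μ : ℝ} (hμ : 0 ≤ μ) (hp : IsPMF p)
    (θ l : ℝ) (hl : 0 ≤ l) (hl1 : l ≤ 1/60000000) :
    TP K (4*μ) (tok (W3 R C) p) (fun N => if ZZ N ≤ θ then 1 else 0) ≤
      Real.exp (l * θ - l * (∑ t, DD (aN μ R C p t) (bN μ R C p t)) / 2
        + 3600 * l^2 * Vt μ (mr p) (mc p) (fun i => 1 / (R i)) (fun j => 1 / (C j))) := by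
  refine (test_gen K (by positivity) (tok_nonneg (W3_nonneg R C) hp) (tok_sum (W3_sum R C hR hC) hp)
    (aN μ R C p) (bN μ R C p) ?_ ?_ ?_ ?_ (-l) θ _ (fun t => mgf_alt _ _ l hl hl1) _ ?_).trans ?_
  · intro t; rw [tok_W3a R C hp t 0 (by simp), aN_eq R C hμ hp]; ring
  · intro t; rw [tok_W3a R C hp t 1 (by simp), aN_eq R C hμ hp]; ring
  · intro t; rw [tok_W3b R C hp t 2 (by decide), bN_eq R C hμ hp]; ring
  · intro t; rw [tok_W3b R C hp t 3 (by decide), bN_eq R C hμ hp]; ring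
  · intro N
    split_ifs with h
    · rw [← Real.exp_zero, Real.exp_le_exp]; nlinarith
    · exact (Real.exp_pos _).le
  · rw [Real.exp_le_exp, Finset.sum_add_distrib, ← Finset.mul_sum, bN_min R C hR hC hμ hp,
      ← Finset.sum_div, ← Finset.mul_sum]
    apply le_of_eq; ring

lemma acc3_null (hR : ∀ i, (1:ℝ) ≤ R i) (hC : ∀ j, (1:ℝ) ≤ C j) (K : ℕ) {μ : ℝ} (hμ : 0 ≤ μ) (hp : IsPMF p)
    (hprod : IsProduct p) (θ l : ℝ) (hl : 0 ≤ l) (hl1 : l ≤ 1/8) :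
    TP K (4*μ) (tok (W3 R C) p) (fun N => if θ < ZZ N then 1 else 0) ≤
      Real.exp (- l * θ + 1600 * l^2 * Vt μ (mr p) (mc p) (fun i => 1 / (R i)) (fun j => 1 / (C j))) := by
  have hab : aN μ R C p = bN μ R C p := by
    funext t; unfold aN bN; rw [prod_marg hprod]
  refine (test_gen K (by positivity) (tok_nonneg (W3_nonneg R C) hp) (tok_sum (W3_sum R C hR hC) hp)
    (bN μ R C p) (bN μ R C p) ?_ ?_ ?_ ?_ l θ _ (fun t => mgf_null _ l (by rwa [abs_of_nonneg hl])) _ ?_).trans ?_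
  · intro t; rw [tok_W3a R C hp t 0 (by simp), ← hab, aN_eq R C hμ hp]; ring
  · intro t; rw [tok_W3a R C hp t 1 (by simp), ← hab, aN_eq R C hμ hp]; ring
  · intro t; rw [tok_W3b R C hp t 2 (by decide), bN_eq R C hμ hp]; ring
  · intro t; rw [tok_W3b R C hp t 3 (by decide), bN_eq R C hμ hp]; ring
  · intro N
    split_ifs with h
    · rw [← Real.exp_zero, Real.exp_le_exp]; nlinarith
    · exact (Real.exp_pos _).le
  · rw [Real.exp_le_exp, ← Finset.mul_sum, bN_min R C hR hC hμ hp]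

lemma ratio_mono {t x B : ℝ} (hx : 0 < x) (hxt : x ≤ t) (hB : 0 ≤ B) : x^2/(x+B) ≤ t^2/(t+B) := by
  rw [div_le_div_iff₀ (by linarith) (by linarith)]
  nlinarith [mul_nonneg (mul_nonneg hx.le (hx.le.trans hxt)) (sub_nonneg.mpr hxt),
    mul_nonneg (mul_nonneg (sub_nonneg.mpr hxt) (add_nonneg hx.le (hx.le.trans hxt))) hB]

lemma DD_sum_ge (hR : ∀ i, (1:ℝ) ≤ R i) (hC : ∀ j, (1:ℝ) ≤ C j) {μ ε D : ℝ} (hμ : 0 < μ) (hε : 0 < ε) (hp : IsPMF p)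
    (hfar : FarFromProduct ε p) (hD : (∑ i, (R i:ℝ)) * (∑ j, (C j:ℝ)) ≤ D) :
    (1/2592) * ((2*μ*ε)^2 / (2*μ*ε + Real.sqrt (D * (D + μ)))) ≤
      ∑ t, DD (aN μ R C p t) (bN μ R C p t) := by
  have hcard : ∑ t : Bins R C, (1:ℝ) ≤ D := by
    rw [bins_sum R C (fun _ _ => 1)]
    refine le_trans (le_of_eq ?_) hD
    rw [Finset.sum_mul_sum]; simp
  have hD0 : 0 ≤ D := le_trans (by positivity) hcard
  have hbsum : ∑ t, (bN μ R C p t : ℝ) = μ := by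
    simp only [bN_eq R C hμ.le hp]
    rw [bins_sum R C (fun i j => (μ * (1/(R i) * (1 / (C j)) * (mr p i * mc p j))))]
    have : ∀ i j, (R i:ℝ) * C j * (μ * (1/(R i) * (1 / (C j)) * (mr p i * mc p j))) = μ * (mr p i * mc p j) := by
      intro i j
      have h1 : (R i:ℝ) ≠ 0 := by linarith [hR i]
      have h2 : (C j:ℝ) ≠ 0 := by linarith [hC j]
      field_simp
    simp only [this, ← Finset.mul_sum, (mc_pmf hp).2, (mr_pmf hp).2, mul_one]
  have hdsum : 2 * μ * ε ≤ ∑ t, |(aN μ R C p t : ℝ) - bN μ R C p t| := by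
    simp only [aN_eq R C hμ.le hp, bN_eq R C hμ.le hp]
    rw [bins_sum R C (fun i j => |(μ * (1/(R i) * (1 / (C j)) * p (i,j))) - (μ * (1/(R i) * (1 / (C j)) * (mr p i * mc p j)))|)]
    have : ∀ i j, (R i:ℝ) * C j * |(μ * (1/(R i) * (1 / (C j)) * p (i,j))) - (μ * (1/(R i) * (1 / (C j)) * (mr p i * mc p j)))|
        = μ * |p (i,j) - mr p i * mc p j| := by
      intro i j
      have h1 : (R i:ℝ) ≠ 0 := by linarith [hR i]
      have h2 : (C j:ℝ) ≠ 0 := by linarith [hC j]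
      rw [← mul_sub, ← mul_sub, abs_mul, abs_mul, abs_of_pos hμ, abs_of_nonneg (by positivity)]
      field_simp
    simp only [this, ← Finset.mul_sum]
    have h := hfar (mr p) (mc p) (mr_pmf hp) (mc_pmf hp)
    rw [Fintype.sum_prod_type] at h
    nlinarith
  have hsq : ∑ t, Real.sqrt (1 + bN μ R C p t) ≤ Real.sqrt (D * (D + μ)) := by
    apply Real.le_sqrt_of_sq_le
    have h := Finset.sum_mul_sq_le_sq_mul_sq Finset.univ (fun _ : Bins R C => (1:ℝ)) (fun t => Real.sqrt (1 + bN μ R C p t))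
    simp only [one_mul, one_pow] at h
    refine h.trans ?_
    have e : ∑ t, Real.sqrt (1 + bN μ R C p t)^2 = ∑ t : Bins R C, (1:ℝ) + μ := by
      have : ∑ t, Real.sqrt (1 + bN μ R C p t)^2 = ∑ t, (1 + (bN μ R C p t : ℝ)) :=
        Finset.sum_congr rfl fun t _ => Real.sq_sqrt (by positivity)
      rw [this, Finset.sum_add_distrib, hbsum]
    rw [e]
    have : (0:ℝ) ≤ ∑ t : Bins R C, (1:ℝ) := by positivity
    gcongr
  have hcs := Finset.sq_sum_div_le_sum_sq_div Finset.univ (fun t => |(aN μ R C p t : ℝ) - bN μ R C p t|)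
    (g := fun t => |(aN μ R C p t : ℝ) - bN μ R C p t| + Real.sqrt (1 + bN μ R C p t)) (fun t _ => by positivity)
  calc _ ≤ (1/2592) * ∑ t, (|(aN μ R C p t : ℝ) - bN μ R C p t|^2 / (|(aN μ R C p t : ℝ) - bN μ R C p t| + Real.sqrt (1 + bN μ R C p t))) := by
        refine mul_le_mul_of_nonneg_left (le_trans ?_ hcs) (by norm_num)
        have hx : 0 < 2 * μ * ε := by positivity
        refine (ratio_mono hx hdsum (Real.sqrt_nonneg _)).trans ?_
        refine div_le_div_of_nonneg_left (sq_nonneg _) ?_ ?_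
        · rw [Finset.sum_add_distrib]
          have : 0 ≤ ∑ t, Real.sqrt (1 + bN μ R C p t) := Finset.sum_nonneg fun _ _ => Real.sqrt_nonneg _
          linarith
        · rw [Finset.sum_add_distrib]; linarith
    _ ≤ _ := by
        rw [Finset.mul_sum]
        exact Finset.sum_le_sum fun t _ => DD_ge _ _
end st3


section comb
variable {T : Type*} [Fintype T] [DecidableEq T]

open Classical in
lemma TP_up (K : ℕ) {μ : ℝ} (hμ : 0 ≤ μ) {w : T → ℝ} (hw0 : ∀ τ, 0 ≤ w τ) (hw : ∑ τ, w τ = 1)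
    {f : (T → ℕ) → ℝ} {c e : ℝ} (hc : 0 ≤ c) (P : (T → ℕ) → Prop)
    (h : ∀ N : T → ℕ, ∑ τ, N τ ≤ K → f N ≤ (if P N then 1 else 0) + c)
    (he : TP K μ w (fun N => if P N then 1 else 0) ≤ e) : TP K μ w f ≤ e + c := by
  refine (TP_mono K hμ hw0 h).trans ?_
  rw [TP_add]
  have h1 := TP_smul K μ w c (fun _ => 1)
  rw [TP_one K μ w hw] at h1
  simp only [mul_one] at h1
  rw [h1]
  have := po_sum_le K hμ
  nlinarith

open Classical in
lemma TP_low (K : ℕ) {μ : ℝ} (hK : μ = K/4) {w : T → ℝ} (hw0 : ∀ τ, 0 ≤ w τ) (hw : ∑ τ, w τ = 1)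
    {f : (T → ℕ) → ℝ} {c e : ℝ} (hc : c ≤ 1) (P : (T → ℕ) → Prop)
    (h : ∀ N : T → ℕ, ∑ τ, N τ ≤ K → c - (if P N then 1 else 0) ≤ f N)
    (he : TP K μ w (fun N => if P N then 1 else 0) ≤ e) : c - Real.exp (-K/2) - e ≤ TP K μ w f := by
  have hμ : 0 ≤ μ := by rw [hK]; positivity
  refine le_trans ?_ (TP_mono K hμ hw0 h)
  rw [TP_sub]
  have h1 := TP_smul K μ w c (fun _ => 1)
  rw [TP_one K μ w hw] at h1
  simp only [mul_one] at h1
  rw [h1]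
  have h2 := po_sum_le K hμ
  have h3 := po_sum_ge K
  rw [← hK] at h3
  nlinarith
end comb

section assemble
variable {n m : ℕ}

/-- acceptance probability of the full tester -/
noncomputable def accF (n m K : ℕ) (μ F θ : ℝ) (p : Fin n × Fin m → ℝ) : ℝ :=
  TP K μ (tok W1 p) (fun N2 => TP K μ (tok W2 p) (fun N1 =>
    TP (4*K) (4*μ) (tok (W3 (fun i => spl F μ (N1 i)) (fun j => spl m μ (N2 j))) p)
      (fun N => if ZZ N ≤ θ then 1 else 0)))

lemma accF_Ach (n m K : ℕ) {μ : ℝ} (hμ : 0 ≤ μ) (F θ : ℝ) : Ach (12 * K) (accF n m K μ F θ) := by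
  have : 12 * K = 0 + 2 * (4 * K) + 2 * K + 2 * K := by ring
  rw [this]
  unfold accF
  refine Ach_TP W1_nonneg W1_sum K hμ fun N2 => Ach_TP W2_nonneg W2_sum K hμ fun N1 =>
    Ach_TP (W3_nonneg _ _) (W3_sum _ _ (fun i => spl_pos _ _ _) (fun i => spl_pos _ _ _)) (4*K) (by positivity) fun N => ?_
  split_ifs
  · exact Ach_const 1 zero_le_one le_rfl
  · exact Ach_const 0 le_rfl zero_le_one

lemma accF_sound {K : ℕ} {μ F θ l L V : ℝ} (hK : μ = K/4) (hm : 1 ≤ m) (hmn : m ≤ n) (hmμ : (m:ℝ) ≤ μ)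
    (hF : F = min μ n) (hl : 0 ≤ l) (hl1 : l ≤ 1/60000000)
    (hV : min μ (257*(4*μ^2/(F*m)+512+16*L)+16*L) ≤ V) {ε : ℝ} (hε : 0 < ε)
    (hs : l * θ - l * ((1/2592) * ((2*μ*ε)^2 / (2*μ*ε + Real.sqrt (25*n*m * (25*n*m + μ)))))/2 + 3600 * l^2 * V ≤ -L)
    {p : Fin n × Fin m → ℝ} (hp : IsPMF p) (hfar : FarFromProduct ε p) :
    accF n m K μ F θ p ≤ 3 * Real.exp (-L) := by
  have hm1 : (1:ℝ) ≤ m := by exact_mod_cast hm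
  have hmn1 : (m:ℝ) ≤ n := by exact_mod_cast hmn
  have hμ : 0 < μ := by linarith
  have hmF : (m:ℝ) ≤ F := by rw [hF]; exact le_min hmμ hmn1
  have hF0 : 0 < F := by linarith
  have hFn : F ≤ n := by rw [hF]; exact min_le_right _ _
  have hcol := flat_col (T := Fin m) K hμ (by simp) hm1 hmF (mc_pmf hp).1 (mc_pmf hp).2 L
  have hK4 : (K:ℝ) = 4 * μ := by rw [hK]; ring
  unfold accF
  rw [tok_W1 hp, tok_W2 hp]
  have : 3 * Real.exp (-L) = Real.exp (-L) + 2 * Real.exp (-L) := by ring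
  rw [this]
  classical
  refine TP_up K hμ.le (mc_pmf hp).1 (mc_pmf hp).2 (by positivity)
    (fun N => 4 * μ^2/(F*m) + 512 + 16 * L < Bc F μ (mc p) (fun j => 1 / (spl m μ (N j)))) ?_ (by convert hcol)
  intro N2 hN2
  have hκ0 : ∀ j, (0:ℝ) ≤ 1 / (spl m μ (N2 j)) := fun j => by positivity
  have hκ1 : ∀ j, 1 / (spl m μ (N2 j) : ℝ) ≤ 1 := fun j => by
    have := spl_pos m μ (N2 j)
    exact (div_le_one (by linarith)).mpr this
  have hrow := flat_row K hμ hF0 (by simpa using hF) (mr_pmf hp).1 (mc_pmf hp).1 (mr_pmf hp).2 (mc_pmf hp).2 _ hκ0 hκ1 L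
  have hle : ∀ N1 : Fin n → ℕ, TP (4*K) (4*μ) (tok (W3 (fun i => spl F μ (N1 i)) (fun j => spl m μ (N2 j))) p)
      (fun N => if ZZ N ≤ θ then 1 else 0) ≤ 1 := by
    intro N1
    refine (TP_mono (4*K) (by positivity) (tok_nonneg (W3_nonneg _ _) hp) (g := fun _ => 1) ?_).trans ?_
    · intro N _; split_ifs <;> norm_num
    · rw [TP_one _ _ _ (tok_sum (W3_sum _ _ (fun i => spl_pos _ _ _) (fun i => spl_pos _ _ _)) hp)]
      exact po_sum_le _ (by positivity)
  split_ifs with hbad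
  · refine (TP_mono K hμ.le (mr_pmf hp).1 (g := fun _ => 1) fun N1 _ => hle N1).trans ?_
    rw [TP_one _ _ _ (mr_pmf hp).2]
    have := po_sum_le K hμ.le
    have := Real.exp_pos (-L)
    linarith
  rw [zero_add, two_mul]
  push Not at hbad
  refine TP_up K hμ.le (mr_pmf hp).1 (mr_pmf hp).2 (by positivity)
    (fun N => 257 * Bc F μ (mc p) (fun j => 1 / (spl m μ (N2 j))) + 16 * L <
      Vt μ (mr p) (mc p) (fun i => 1 / (spl F μ (N i))) (fun j => 1 / (spl m μ (N2 j)))) ?_ (by convert hrow)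
  intro N1 hN1
  split_ifs with hbad2
  · linarith [hle N1, Real.exp_pos (-L)]
  push Not at hbad2
  rw [zero_add]
  refine (acc3_sound _ _ (fun i => spl_pos _ _ _) (fun i => spl_pos _ _ _) (4*K) hμ.le hp θ l hl hl1).trans ?_
  rw [Real.exp_le_exp]
  refine le_trans ?_ hs
  have hVt : Vt μ (mr p) (mc p) (fun i => 1 / (spl F μ (N1 i))) (fun j => 1 / (spl m μ (N2 j))) ≤ V := by
    refine le_trans (le_min (Vt_le_mu μ (mr_pmf hp).2 (mc_pmf hp).2 _ _) (hbad2.trans ?_)) hV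
    gcongr
  have hDD := DD_sum_ge (fun i => spl F μ (N1 i)) (fun j => spl m μ (N2 j)) (fun i => spl_pos _ _ _) (fun i => spl_pos _ _ _)
    hμ hε hp hfar (D := 25*n*m) (by
      have h1 := spl_sum F μ hF0.le hμ N1 K hK4 hN1
      have h2 := spl_sum m μ (by linarith) hμ N2 K hK4 hN2
      simp only [Fintype.card_fin] at h1 h2
      calc _ ≤ (5 * (n:ℝ)) * (5 * m) := by
            apply mul_le_mul
            · refine le_trans ?_ (h1.trans (by linarith)); exact le_rfl
            · refine le_trans ?_ (h2.trans (by linarith)); exact le_rfl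
            · positivity
            · positivity
        _ = _ := by ring)
  have h5 := mul_le_mul_of_nonneg_left hDD hl
  have h6 := mul_le_mul_of_nonneg_left hVt (by positivity : 0 ≤ 3600 * l^2)
  linarith

lemma accF_null {K : ℕ} {μ F θ l L V : ℝ} (hK : μ = K/4) (hm : 1 ≤ m) (hmn : m ≤ n) (hmμ : (m:ℝ) ≤ μ)
    (hF : F = min μ n) (hl : 0 ≤ l) (hl1 : l ≤ 1/60000000)
    (hV : min μ (257*(4*μ^2/(F*m)+512+16*L)+16*L) ≤ V) (hKL : 2 * L ≤ K)
    (hs : -l * θ + 1600 * l^2 * V ≤ -L)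
    {p : Fin n × Fin m → ℝ} (hp : IsPMF p) (hprod : IsProduct p) :
    1 - 6 * Real.exp (-L) ≤ accF n m K μ F θ p := by
  have hm1 : (1:ℝ) ≤ m := by exact_mod_cast hm
  have hmn1 : (m:ℝ) ≤ n := by exact_mod_cast hmn
  have hμ : 0 < μ := by linarith
  have hmF : (m:ℝ) ≤ F := by rw [hF]; exact le_min hmμ hmn1
  have hF0 : 0 < F := by linarith
  have hFn : F ≤ n := by rw [hF]; exact min_le_right _ _
  have hcol := flat_col (T := Fin m) K hμ (by simp) hm1 hmF (mc_pmf hp).1 (mc_pmf hp).2 L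
  have hK4 : (K:ℝ) = 4 * μ := by rw [hK]; ring
  have hη : Real.exp (-K/2) ≤ Real.exp (-L) := by rw [Real.exp_le_exp]; linarith
  have hη4 : Real.exp (-(4*K:ℕ)/2) ≤ Real.exp (-L) := by
    rw [Real.exp_le_exp]; push_cast; linarith
  have hL0 := Real.exp_pos (-L)
  unfold accF
  rw [tok_W1 hp, tok_W2 hp]
  classical
  have hnn : ∀ (N1 : Fin n → ℕ) (N2 : Fin m → ℕ), 0 ≤ TP (4*K) (4*μ) (tok (W3 (fun i => spl F μ (N1 i)) (fun j => spl m μ (N2 j))) p)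
      (fun N => if ZZ N ≤ θ then 1 else 0) := by
    intro N1 N2
    refine le_trans (le_of_eq ?_) (TP_mono (4*K) (by positivity) (tok_nonneg (W3_nonneg _ _) hp) (f := fun _ => 0) ?_)
    · simp [TP]
    · intro N _; split_ifs <;> norm_num
  refine le_trans ?_ (TP_low K hK (mc_pmf hp).1 (mc_pmf hp).2 (c := 1 - 4 * Real.exp (-L)) (by linarith)
    (fun N => 4 * μ^2/(F*m) + 512 + 16 * L < Bc F μ (mc p) (fun j => 1 / (spl m μ (N j)))) ?_ (by convert hcol))
  · linarith
  intro N2 hN2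
  have hκ0 : ∀ j, (0:ℝ) ≤ 1 / (spl m μ (N2 j)) := fun j => by positivity
  have hκ1 : ∀ j, 1 / (spl m μ (N2 j) : ℝ) ≤ 1 := fun j => by
    have := spl_pos m μ (N2 j)
    exact (div_le_one (by linarith)).mpr this
  have hrow := flat_row K hμ hF0 (by simpa using hF) (mr_pmf hp).1 (mc_pmf hp).1 (mr_pmf hp).2 (mc_pmf hp).2 _ hκ0 hκ1 L
  split_ifs with hbad
  · have : 0 ≤ TP K μ (mr p) (fun N1 => TP (4*K) (4*μ) (tok (W3 (fun i => spl F μ (N1 i)) (fun j => spl m μ (N2 j))) p)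
      (fun N => if ZZ N ≤ θ then 1 else 0)) := by
      refine le_trans (le_of_eq ?_) (TP_mono K hμ.le (mr_pmf hp).1 (f := fun _ => 0) fun N1 _ => hnn N1 N2)
      simp [TP]
    linarith
  push Not at hbad
  refine le_trans ?_ (TP_low K hK (mr_pmf hp).1 (mr_pmf hp).2 (c := 1 - 2 * Real.exp (-L)) (by linarith)
    (fun N => 257 * Bc F μ (mc p) (fun j => 1 / (spl m μ (N2 j))) + 16 * L <
      Vt μ (mr p) (mc p) (fun i => 1 / (spl F μ (N i))) (fun j => 1 / (spl m μ (N2 j)))) ?_ (by convert hrow))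
  · linarith
  intro N1 hN1
  split_ifs with hbad2
  · linarith [hnn N1 N2]
  push Not at hbad2
  have hVt : Vt μ (mr p) (mc p) (fun i => 1 / (spl F μ (N1 i))) (fun j => 1 / (spl m μ (N2 j))) ≤ V := by
    refine le_trans (le_min (Vt_le_mu μ (mr_pmf hp).2 (mc_pmf hp).2 _ _) (hbad2.trans ?_)) hV
    gcongr
  have h3 := acc3_null (fun i => spl F μ (N1 i)) (fun j => spl m μ (N2 j)) (fun i => spl_pos _ _ _) (fun i => spl_pos _ _ _)
    (4*K) hμ.le hp hprod θ l hl (by linarith)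
  refine le_trans ?_ (TP_low (4*K) (by rw [hK]; push_cast; ring) (tok_nonneg (W3_nonneg _ _) hp)
    (tok_sum (W3_sum _ _ (fun i => spl_pos _ _ _) (fun i => spl_pos _ _ _)) hp) (c := 1) le_rfl
    (fun N => θ < ZZ N) ?_ (e := Real.exp (-L)) ?_)
  · linarith
  · intro N _
    split_ifs with h1 h2 h2 <;> linarith
  · refine le_trans (by convert h3) (Real.exp_le_exp.mpr (le_trans ?_ hs))
    have h6 := mul_le_mul_of_nonneg_left hVt (by positivity : 0 ≤ 1600 * l^2)
    linarith
end assemble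


lemma param1 {G V L : ℝ} (hG : 0 < G) (hV : 0 < V)
    (h1 : 2*10^12 * L ≤ G) (h2 : 2*10^12 * V * L ≤ G^2) :
    ∃ l θ : ℝ, 0 ≤ l ∧ l ≤ 1/60000000 ∧ l * θ - l * ((1/2592) * G)/2 + 3600 * l^2 * V ≤ -L ∧
      -l * θ + 1600 * l^2 * V ≤ -L := by
  set l := min (1/60000000) ((1/2592) * G / (28800 * V)) with hl
  have hl0 : 0 ≤ l := le_min (by norm_num) (by positivity)
  have hlV : l * V ≤ (1/2592) * G / 28800 := by
    have : l ≤ (1/2592) * G / (28800 * V) := min_le_right _ _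
    calc l * V ≤ (1/2592) * G / (28800 * V) * V := by gcongr
      _ = _ := by field_simp
  have hlL : L ≤ l * ((1/2592) * G) / 8 := by
    rcases min_cases (1/60000000 : ℝ) ((1/2592) * G / (28800 * V)) with ⟨e, _⟩ | ⟨e, _⟩
    · rw [hl, e]; linarith
    · rw [hl, e]
      have : (1/2592) * G / (28800 * V) * ((1/2592) * G) / 8 = G^2 / (2592^2 * 230400 * V) := by
        field_simp; ring
      rw [this, le_div_iff₀ (by positivity)]
      by_cases hL : 0 ≤ L
      · nlinarith [mul_nonneg hL hV.le]
      · push Not at hL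
        nlinarith [mul_neg_of_neg_of_pos hL hV, sq_nonneg G]
  have hq : 3600 * l^2 * V ≤ l * ((1/2592) * G) / 8 := by
    have := mul_le_mul_of_nonneg_left hlV hl0
    nlinarith
  have hq0 : 0 ≤ l^2 * V := by positivity
  refine ⟨l, (1/2592) * G / 4, hl0, min_le_left _ _, ?_, ?_⟩
  · nlinarith
  · nlinarith

lemma three_cases {x B P s : ℝ} (hx : 0 < x) (hB : 0 ≤ B) (hBs : B ≤ P + s) (hP : 0 < P) (hs : 0 < s) :
    x^2/(3*x) ≤ x^2/(x+B) ∨ x^2/(3*P) ≤ x^2/(x+B) ∨ x^2/(3*s) ≤ x^2/(x+B) := by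
  have key : ∀ y, x + B ≤ y → x^2/y ≤ x^2/(x+B) := fun y hy =>
    div_le_div_of_nonneg_left (sq_nonneg x) (by linarith) hy
  rcases le_total P x with h1 | h1
  · rcases le_total s x with h2 | h2
    · left; apply key; linarith
    · right; right; apply key; linarith
  · rcases le_total s P with h2 | h2
    · right; left; apply key; linarith
    · right; right; apply key; linarith

set_option maxHeartbeats 1000000 in
lemma param2 {n m ε L L' μ F : ℝ} (hm : 1 ≤ m) (hmn : m ≤ n) (hε : 0 < ε) (hε1 : ε < 1) (hL : 1/2 ≤ L)
    (hL0 : 0 ≤ L') (hL' : L' ≤ 4 * L) (hμ : 0 < μ) (hF : F = min μ n)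
    (H1 : 10^20 * (n^2*m*L) ≤ μ^3*ε^4) (H2 : 10^20 * (n*m*L) ≤ μ^2*ε^4) (H3 : 10^20 * L ≤ μ * ε^2) :
    ∃ l θ V : ℝ, 0 ≤ l ∧ l ≤ 1/60000000 ∧ min μ (257*(4*μ^2/(F*m)+512+16*L')+16*L') ≤ V ∧
     l * θ - l * ((1/2592) * ((2*μ*ε)^2 / (2*μ*ε + Real.sqrt (25*n*m * (25*n*m + μ)))))/2 + 3600 * l^2 * V ≤ -L' ∧
     -l * θ + 1600 * l^2 * V ≤ -L' := by
  have hn : 1 ≤ n := hm.trans hmn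
  have hF0 : 0 < F := by rw [hF]; exact lt_min hμ (by linarith)
  have hm0 : 0 < m := by linarith
  have hn0 : 0 < n := by linarith
  have hLp : 0 < L := by linarith
  set G := (2*μ*ε)^2 / (2*μ*ε + Real.sqrt (25*n*m * (25*n*m + μ))) with hG
  set V0 := 257*(4*μ^2/(F*m)+512+16*L')+16*L' with hV0
  have hV0p : 0 < V0 := by positivity
  have hGp : 0 < G := by positivity
  have hε2 : ε^2 ≤ ε := by nlinarith
  have hε4 : ε^4 ≤ ε^2 := by nlinarith [sq_nonneg ε, sq_nonneg (ε^2)]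
  have hVp : 0 < min μ V0 := lt_min hμ hV0p
  suffices hh : 8*10^12 * L ≤ G ∧ 8*10^12 * min μ V0 * L ≤ G^2 by
    obtain ⟨l, θ, h1, h2, h3, h4⟩ := param1 (L := L') hGp hVp (by linarith [hh.1])
      (le_trans (by nlinarith [mul_le_mul_of_nonneg_left hL' hVp.le]) hh.2)
    exact ⟨l, θ, _, h1, h2, le_rfl, h3, h4⟩
  have hs2 : Real.sqrt (n*m*μ)^2 = n*m*μ := Real.sq_sqrt (by positivity)
  have hs0 : 0 < Real.sqrt (n*m*μ) := Real.sqrt_pos.mpr (by positivity)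
  set s := Real.sqrt (n*m*μ) with hs
  have hB : Real.sqrt (25*n*m * (25*n*m + μ)) ≤ 25*n*m + 5*s := by
    apply Real.sqrt_le_iff.mpr
    refine ⟨by positivity, ?_⟩
    nlinarith [mul_pos (mul_pos hn0 hm0) hs0]
  have hx : 0 < 2*μ*ε := by positivity
  rcases three_cases hx (Real.sqrt_nonneg _) hB (by positivity) (by positivity) with hc | hc | hc
  · have hg : 2*μ*ε/3 ≤ G := by
      refine le_trans (le_of_eq ?_) hc
      field_simp
    have h4 : μ * ε^2 ≤ μ * ε := by gcongr
    constructor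
    · linarith
    · calc 8*10^12 * min μ V0 * L ≤ 8*10^12 * μ * L := by gcongr; exact min_le_left _ _
        _ ≤ (2*μ*ε/3)^2 := by
          have := mul_le_mul_of_nonneg_left H3 hμ.le
          nlinarith [mul_pos hμ hLp]
        _ ≤ G^2 := by gcongr
  · have hg : 4*(μ^2*ε^2/(n*m))/75 ≤ G := by
      refine le_trans (le_of_eq ?_) hc
      field_simp; ring
    set u := μ^2*ε^2/(n*m) with hu
    have hnm : 0 < n*m := by positivity
    have hu1 : 10^20 * L ≤ u := by
      rw [hu, le_div_iff₀ hnm]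
      have : μ^2*ε^4 ≤ μ^2*ε^2 := by gcongr
      linarith
    have hu2 : u^2 = μ^4*ε^4/(n*m)^2 := by rw [hu]; field_simp
    have hu3 : 10^20 * (μ^2/(n*m)) * L ≤ u^2 := by
      rw [hu2, le_div_iff₀ (by positivity)]
      have := mul_le_mul_of_nonneg_left H2 (sq_nonneg μ)
      calc _ = μ^2 * (10^20 * (n*m*L)) := by field_simp
        _ ≤ _ := this
        _ = _ := by ring
    have hu4 : 10^20 * (μ/m) * L ≤ u^2 := by
      rw [hu2, le_div_iff₀ (by positivity)]
      have := mul_le_mul_of_nonneg_left H1 hμ.le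
      calc _ = μ * (10^20 * (n^2*m*L)) := by field_simp
        _ ≤ _ := this
        _ = _ := by ring
    have hFm : μ^2/(F*m) ≤ μ/m + μ^2/(n*m) := by
      rw [hF]
      rcases min_cases μ n with ⟨e, _⟩ | ⟨e, _⟩ <;> rw [e]
      · have : μ^2/(μ*m) = μ/m := by field_simp
        rw [this]
        have : 0 ≤ μ^2/(n*m) := by positivity
        linarith
      · have : 0 ≤ μ/m := by positivity
        linarith
    have hV : V0 ≤ 1028*(μ/m) + 1028*(μ^2/(n*m)) + 300000*L := by
      have : 4*μ^2/(F*m) = 4*(μ^2/(F*m)) := by ring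
      rw [hV0, this]
      linarith
    have hu0 : 0 < u := by positivity
    have hu6 : (10^20 * L)^2 ≤ u^2 := by gcongr
    have hu5 : 10^20 * L * L ≤ u^2 := by nlinarith
    constructor
    · linarith
    · calc 8*10^12 * min μ V0 * L ≤ 8*10^12 * (1028*(μ/m) + 1028*(μ^2/(n*m)) + 300000*L) * L := by
            gcongr; exact (min_le_right _ _).trans hV
        _ ≤ (4*u/75)^2 := by
          have e1 : (8*10^12 * (1028*(μ/m) + 1028*(μ^2/(n*m)) + 300000*L) * L : ℝ) =
            (8*10^12*1028/10^20) * (10^20 * (μ/m) * L) + (8*10^12*1028/10^20) * (10^20 * (μ^2/(n*m)) * L)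
              + (8*10^12*300000/10^20) * (10^20 * L * L) := by ring
          have e2 : (4*u/75)^2 = (16/5625) * u^2 := by ring
          rw [e1, e2]
          generalize u^2 = z at *
          linarith
        _ ≤ G^2 := by
          have : 0 < u := by positivity
          gcongr
  · have hg : 4*(μ^2*ε^2/s)/15 ≤ G := by
      refine le_trans (le_of_eq ?_) hc
      field_simp; ring
    have hnm : 0 < n*m := by positivity
    set v := μ^2*ε^2/s with hv
    have hv2 : v^2 = μ^3*ε^4/(n*m) := by
      rw [hv, div_pow, hs2]; field_simp
    have hv3 : 10^20 * μ * L ≤ v^2 := by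
      rw [hv2, le_div_iff₀ hnm]
      have := mul_le_mul_of_nonneg_left H2 hμ.le
      nlinarith
    have hμL : 10^20 * L ≤ μ := by nlinarith
    have hv0 : 0 < v := by positivity
    constructor
    · have : (10^20*L)^2 ≤ v^2 := by nlinarith
      have := (sq_le_sq₀ (by positivity) hv0.le).mp this
      linarith
    · calc 8*10^12 * min μ V0 * L ≤ 8*10^12 * μ * L := by gcongr; exact min_le_left _ _
        _ ≤ (4*v/15)^2 := by nlinarith [mul_pos hμ hLp]
        _ ≤ G^2 := by gcongr


set_option maxHeartbeats 2000000 in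
lemma main_small {n m : ℕ} (hm : 1 ≤ m) (hmn : m ≤ n) {ε δ : ℝ} (hε : 0 < ε) (hε1 : ε < 1) (hδ : 0 < δ)
    (hδ1 : δ < 1/2) {k : ℕ}
    (hk : 96 * 10^20 * ((n : ℝ) ^ ((2 : ℝ) / 3) * (m : ℝ) ^ ((1 : ℝ) / 3)
                * Real.log (1 / δ) ^ ((1 : ℝ) / 3) / ε ^ ((4 : ℝ) / 3)
              + (((n : ℝ) * (m : ℝ) * Real.log (1 / δ)) ^ ((1 : ℝ) / 2)
                  + Real.log (1 / δ)) / ε ^ 2) ≤ k) :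
    ∃ h : (Fin n × Fin m → ℝ) → ℝ, Ach k h ∧ ∀ p, IsPMF p →
      (IsProduct p → 1 - δ ≤ h p) ∧ (FarFromProduct ε p → h p ≤ δ) := by
  set L := Real.log (1/δ) with hLdef
  have hLlog : L = - Real.log δ := by rw [hLdef, one_div, Real.log_inv]
  have hlog2 := Real.log_two_gt_d9
  have hL2 : Real.log 2 ≤ L := by
    apply Real.log_le_log (by norm_num)
    rw [le_div_iff₀ hδ]; linarith
  have hL : 1/2 ≤ L := by linarith
  have hLp : 0 < L := by linarith
  have hm1 : (1:ℝ) ≤ m := by exact_mod_cast hm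
  have hmn1 : (m:ℝ) ≤ n := by exact_mod_cast hmn
  have hn1 : (1:ℝ) ≤ n := hm1.trans hmn1
  set L' := L + Real.log 8 with hL'def
  have hlog8 : Real.log 8 = 3 * Real.log 2 := by
    rw [show (8:ℝ) = 2^(3:ℕ) by norm_num, Real.log_pow]; norm_num
  have hexp : Real.exp (-L') = δ / 8 := by
    rw [hL'def, neg_add, Real.exp_add, hLlog, neg_neg, Real.exp_log hδ, Real.exp_neg, Real.exp_log (by norm_num)]
    ring
  have hL'4 : L' ≤ 4 * L := by rw [hL'def, hlog8]; linarith
  have hL'0 : 0 ≤ L' := by rw [hL'def, hlog8]; linarith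
  set Q1 := (n : ℝ) ^ ((2 : ℝ) / 3) * (m : ℝ) ^ ((1 : ℝ) / 3) * L ^ ((1 : ℝ) / 3) / ε ^ ((4 : ℝ) / 3) with hQ1
  set S := ((n : ℝ) * (m : ℝ) * L) ^ ((1 : ℝ) / 2) with hS
  have hQ10 : 0 < Q1 := by positivity
  have hS0 : 0 < S := by positivity
  have hcube : Q1^3 * ε^4 = n^2*m*L := by
    have h3 : ∀ (x y : ℝ) (c : ℕ), 0 ≤ x → y * 3 = c → (x ^ y)^3 = x^c := by
      intro x y c hx hy
      rw [← Real.rpow_mul_natCast hx]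
      rw [← Real.rpow_natCast, ← hy]
      norm_num
    rw [hQ1, div_pow, mul_pow, mul_pow, h3 n _ 2 (by positivity) (by norm_num), h3 m _ 1 (by positivity) (by norm_num),
      h3 L _ 1 hLp.le (by norm_num), h3 ε _ 4 hε.le (by norm_num)]
    field_simp
  have hsq : S^2 = n*m*L := by
    rw [hS, ← Real.rpow_mul_natCast (by positivity)]; norm_num
  set K := k / 12 with hKdef
  have hε2 : ε^2 < 1 := by nlinarith
  have hε20 : 0 < ε^2 := by positivity
  have hLε : L ≤ L/ε^2 := by rw [le_div_iff₀ hε20]; nlinarith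
  have hSε : 0 ≤ S/ε^2 := by positivity
  rw [add_div] at hk
  have hk24 : (24:ℝ) ≤ k := by nlinarith
  have hk24' : 24 ≤ k := by exact_mod_cast hk24
  have hKk : (k:ℝ) ≤ 24 * K := by
    have : k ≤ 24 * K := by omega
    exact_mod_cast this
  set μ : ℝ := K/4 with hμ
  have hμQ : 10^20 * (Q1 + (S/ε^2 + L/ε^2)) ≤ μ := by linarith
  have hμ1 : 10^20 * Q1 ≤ μ := by linarith
  have hμ2 : 10^20 * (S/ε^2) ≤ μ := by linarith
  have hμ3 : 10^20 * (L/ε^2) ≤ μ := by linarith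
  have hμ0 : 0 < μ := lt_of_lt_of_le (by positivity) hμ1
  have H1 : 10^20 * ((n:ℝ)^2*m*L) ≤ μ^3*ε^4 := by
    rw [← hcube]
    have : (10^20 * Q1)^3 ≤ μ^3 := by gcongr
    have h4 : 0 < ε^4 := by positivity
    have h5 := mul_le_mul_of_nonneg_right this h4.le
    refine le_trans ?_ h5
    have : 0 < Q1^3*ε^4 := by positivity
    calc _ ≤ (10^20)^3 * (Q1^3*ε^4) := by gcongr; norm_num
      _ = _ := by ring
  have H2 : 10^20 * ((n:ℝ)*m*L) ≤ μ^2*ε^4 := by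
    rw [← hsq]
    have : (10^20 * (S/ε^2))^2 ≤ μ^2 := by gcongr
    have h4 : 0 < ε^4 := by positivity
    have h5 := mul_le_mul_of_nonneg_right this h4.le
    refine le_trans ?_ h5
    have : 0 < S^2 := by positivity
    calc _ ≤ (10^20)^2 * S^2 := by gcongr; norm_num
      _ = _ := by field_simp
  have H3 : 10^20 * L ≤ μ * ε^2 := by
    have := mul_le_mul_of_nonneg_right hμ3 hε20.le
    refine le_trans (le_of_eq ?_) this
    field_simp
  have hmμ : (m:ℝ) ≤ μ := by
    have h1 : (m:ℝ)^2 ≤ μ^2 := by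
      have h2 : μ^2 * ε^4 ≤ μ^2 * 1 := by
        gcongr
        exact pow_le_one₀ hε.le hε1.le
      have h3 : (m:ℝ)^2 ≤ n*m := by nlinarith
      have h4 : (n:ℝ)*m ≤ 10^20*(n*m*L) := by
        have h5 : 0 < (n:ℝ)*m := by positivity
        have h6 : (n:ℝ)*m * (1/2) ≤ n*m*L := mul_le_mul_of_nonneg_left hL h5.le
        linarith
      linarith
    exact (sq_le_sq₀ (by positivity) hμ0.le).mp h1
  have hLμ : 10^20 * L ≤ μ := le_trans H3 (mul_le_of_le_one_right hμ0.le hε2.le)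
  obtain ⟨l, θ, V, hl0, hl1, hV, hs, hn⟩ := param2 hm1 hmn1 hε hε1 hL hL'0 hL'4 hμ0 rfl H1 H2 H3
  refine ⟨accF n m K μ (min μ n) θ, Ach_mono (by omega) (accF_Ach n m K hμ0.le _ _), fun p hp => ⟨fun hprod => ?_, fun hfar => ?_⟩⟩
  · have := accF_null hμ hm hmn hmμ rfl hl0 hl1 hV (by linarith) hn hp hprod
    rw [hexp] at this
    linarith
  · have := accF_sound hμ hm hmn hmμ rfl hl0 hl1 hV hε hs hp hfar
    rw [hexp] at this
    linarith

end helpers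

/-- Independence testing upper bound (Theorem 1.3, upper-bound part). -/
theorem independence_testing_upper_bound :
    ∃ C > (0 : ℝ), ∀ n m : ℕ, 1 ≤ m → m ≤ n →
      ∀ ε δ : ℝ, 0 < ε → ε < 1 → 0 < δ → δ < 1 →
      ∀ k : ℕ,
        k = ⌈C * ((n : ℝ) ^ ((2 : ℝ) / 3) * (m : ℝ) ^ ((1 : ℝ) / 3)
                * Real.log (1 / δ) ^ ((1 : ℝ) / 3) / ε ^ ((4 : ℝ) / 3)
              + (((n : ℝ) * (m : ℝ) * Real.log (1 / δ)) ^ ((1 : ℝ) / 2)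
                  + Real.log (1 / δ)) / ε ^ 2)⌉₊ →
        ∃ A : (Fin k → Fin n × Fin m) → ℝ,
          (∀ x, 0 ≤ A x ∧ A x ≤ 1) ∧
          ∀ p : Fin n × Fin m → ℝ, IsPMF p →
            (IsProduct p → 1 - δ ≤ acceptProb1 p A) ∧
            (FarFromProduct ε p → acceptProb1 p A ≤ δ) := by
  refine ⟨96 * 10^20, by norm_num, ?_⟩
  intro n m hm hmn ε δ hε hε1 hδ hδ1 k hk
  have H : ∃ h : (Fin n × Fin m → ℝ) → ℝ, Ach k h ∧ ∀ p, IsPMF p →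
      (IsProduct p → 1 - δ ≤ h p) ∧ (FarFromProduct ε p → h p ≤ δ) := by
    by_cases hd : δ < 1/2
    · exact main_small hm hmn hε hε1 hδ hd (by rw [hk]; exact Nat.le_ceil _)
    · push Not at hd
      exact ⟨fun _ => 1/2, Ach_mono (Nat.zero_le k) (Ach_const (1/2) (by norm_num) (by norm_num)),
        fun p _ => ⟨fun _ => by linarith, fun _ => hd⟩⟩
  obtain ⟨h, ⟨A, hA, hAp⟩, hh⟩ := H
  refine ⟨A, hA, fun p hp => ?_⟩
  rw [hAp p hp]
  exact hh p hp
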